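/- arXiv:1805.11290 — 5 statements merged into one kernel-verified Lean document; each statement's English description precedes it below -/
import Mathlib

section
/- Let λ > 0. Suppose v ∈ C²(Γ) satisfies: (i) −v_α''(y) + λ v_α(y) = 0 for all y ∈ (0, ℓ_α) and all α ∈ 𝒜; and (ii) the Kirchhoff conditions ∑_{α∈𝒜_i} γ_iα μ_α ∂_α v(ν_i) = 0 for every vertex ν_i, i ∈ I. Then v is identically zero, i.e. v_α ≡ 0 on [0, ℓ_α] for every α ∈ 𝒜. -/
open Set

/-- A connected network: finite vertex set `I`, finite edge set `A`, each edge `α`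
identified with `[0, ℓ α]`, with endpoint `0` attached to `src α` and endpoint `ℓ α`
attached to `tgt α`, these being distinct vertices; the resulting graph is connected. -/
structure Network (I A : Type) [Fintype I] [Fintype A] [DecidableEq I] where
  ℓ : A → ℝ
  ℓ_pos : ∀ α, 0 < ℓ α
  src : A → I
  tgt : A → I
  src_ne_tgt : ∀ α, src α ≠ tgt α
  connected : ∀ i j : I,
    Relation.ReflTransGen
      (fun i j => ∃ α, (src α = i ∧ tgt α = j) ∨ (src α = j ∧ tgt α = i)) i j

namespace Network

variable {I A : Type} [Fintype I] [Fintype A] [DecidableEq I]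

/-- The set `𝒜_i` of edges incident to the vertex `i`. -/
def edges (N : Network I A) (i : I) : Finset A :=
  Finset.univ.filter fun α => N.src α = i ∨ N.tgt α = i

/-- The value `f|_α(ν_i)` of an edgewise family `f` at the vertex `i` along the edge `α`. -/
def vval (N : Network I A) (f : A → ℝ → ℝ) (i : I) (α : A) : ℝ :=
  if N.src α = i then f α 0 else f α (N.ℓ α)

/-- The outward directional derivative `∂_α f(ν_i)`, expressed via the family `f'` of
edgewise first derivatives. -/
def oderiv (N : Network I A) (f' : A → ℝ → ℝ) (i : I) (α : A) : ℝ :=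
  if N.src α = i then -(f' α 0) else f' α (N.ℓ α)

/-- The sign `n_{iα}`: `-1` if `ν_i` is attached to the endpoint `0` of `α`, `+1` if it is
attached to the endpoint `ℓ α`. -/
def sgn (N : Network I A) (i : I) (α : A) : ℝ :=
  if N.src α = i then -1 else 1

/-- `v = (v_α)` is a `C²` function on the network, with first derivatives `v'` and second
derivatives `v''`, continuous at the vertices. -/
def IsC2 (N : Network I A) (v v' v'' : A → ℝ → ℝ) : Prop :=
  (∀ α, ∀ y ∈ Icc (0:ℝ) (N.ℓ α), HasDerivWithinAt (v α) (v' α y) (Icc 0 (N.ℓ α)) y) ∧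
  (∀ α, ∀ y ∈ Icc (0:ℝ) (N.ℓ α), HasDerivWithinAt (v' α) (v'' α y) (Icc 0 (N.ℓ α)) y) ∧
  (∀ α, ContinuousOn (v'' α) (Icc 0 (N.ℓ α))) ∧
  (∀ i : I, ∀ α ∈ N.edges i, ∀ β ∈ N.edges i, N.vval v i α = N.vval v i β)

/-- The Kirchhoff conditions `∑_{α ∈ 𝒜_i} γ_{iα} μ_α ∂_α v(ν_i) = 0` at every vertex. -/
def Kirchhoff (N : Network I A) (μ : A → ℝ) (γ : I → A → ℝ) (v' : A → ℝ → ℝ) : Prop :=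
  ∀ i : I, ∑ α ∈ N.edges i, γ i α * μ α * N.oderiv v' i α = 0

end Network

namespace Network

variable {I A : Type} [Fintype I] [Fintype A] [DecidableEq I]

/-- A solution of the stationary Fokker–Planck problem on the network associated with the
drift `b`: `m` (with edgewise derivative `m'`) is `C¹` on each edge, satisfies the jump
conditions `m|_α(ν_i)/γ_{iα} = m|_β(ν_i)/γ_{iβ}`, the first integral
`μ_α m_α' + b_α m_α = c_α` on each edge, the vertex transmission conditions
`∑_{α ∈ 𝒜_i} [n_{iα} b|_α(ν_i) m|_α(ν_i) + μ_α ∂_α m(ν_i)] = 0`, is nonnegative and has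
total integral `1`. -/
def IsFPSolution (N : Network I A) (μ : A → ℝ) (γ : I → A → ℝ)
    (b : A → ℝ → ℝ) (m m' : A → ℝ → ℝ) : Prop :=
  (∀ α, ∀ y ∈ Icc (0:ℝ) (N.ℓ α), HasDerivWithinAt (m α) (m' α y) (Icc 0 (N.ℓ α)) y) ∧
  (∀ α, ContinuousOn (m' α) (Icc 0 (N.ℓ α))) ∧
  (∀ i : I, ∀ α ∈ N.edges i, ∀ β ∈ N.edges i,
      N.vval m i α / γ i α = N.vval m i β / γ i β) ∧
  (∀ α, ∃ c : ℝ, ∀ y ∈ Icc (0:ℝ) (N.ℓ α), μ α * m' α y + b α y * m α y = c) ∧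
  (∀ i : I, ∑ α ∈ N.edges i,
      (N.sgn i α * N.vval b i α * N.vval m i α + μ α * N.oderiv m' i α) = 0) ∧
  (∀ α, ∀ y ∈ Icc (0:ℝ) (N.ℓ α), 0 ≤ m α y) ∧
  (∑ α : A, ∫ y in (0:ℝ)..(N.ℓ α), m α y) = 1

/-- The standing assumptions on the Hamiltonians `H_α : [0, ℓ_α] × ℝ → ℝ` with partial
derivatives `Hp_α = ∂_p H_α`: `C¹` regularity, convexity in `p`, coercivity
`H_α(x,p) ≥ C₀|p|^q − C₁` and the growth condition `|∂_p H_α(x,p)| ≤ C₂(|p|^{q−1} + 1)`. -/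
def HamHyp (N : Network I A) (H Hp : A → ℝ → ℝ → ℝ) (q C0 C1 C2 : ℝ) : Prop :=
  (∀ α, ContDiffOn ℝ 1 (fun z : ℝ × ℝ => H α z.1 z.2)
      (Icc (0:ℝ) (N.ℓ α) ×ˢ (univ : Set ℝ))) ∧
  (∀ α, ∀ x ∈ Icc (0:ℝ) (N.ℓ α), ∀ p : ℝ, HasDerivAt (fun p => H α x p) (Hp α x p) p) ∧
  (∀ α, ∀ x ∈ Icc (0:ℝ) (N.ℓ α), ConvexOn ℝ univ (fun p => H α x p)) ∧
  (∀ α, ∀ x ∈ Icc (0:ℝ) (N.ℓ α), ∀ p : ℝ, C0 * |p| ^ q - C1 ≤ H α x p) ∧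
  (∀ α, ∀ x ∈ Icc (0:ℝ) (N.ℓ α), ∀ p : ℝ, |Hp α x p| ≤ C2 * (|p| ^ (q - 1) + 1))

/-- A solution `(v, m, ρ)` of the stationary MFG system on the network: `v` is `C²`,
solves the ergodic HJB equation with coupling `F(m)` and the Kirchhoff conditions; `m` is
`C¹` on each edge, satisfies the jump conditions, the first-integral form of the
Fokker–Planck equation `μ_α m_α' + m_α ∂_p H_α(·, v_α') = c_α` with `∑_{α∈𝒜_i} n_{iα} c_α = 0`
at every vertex, `m ≥ 0`, `∫_Γ m = 1` and `∫_Γ v = 0`. -/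
def IsMFGSolution (N : Network I A) (μ : A → ℝ) (γ : I → A → ℝ)
    (H Hp : A → ℝ → ℝ → ℝ) (F : ℝ → ℝ)
    (v v' v'' m m' : A → ℝ → ℝ) (ρ : ℝ) : Prop :=
  IsC2 N v v' v'' ∧
  (∀ α, ∀ y ∈ Ioo (0:ℝ) (N.ℓ α),
      -(μ α * v'' α y) + H α y (v' α y) + ρ = F (m α y)) ∧
  Kirchhoff N μ γ v' ∧
  (∀ α, ∀ y ∈ Icc (0:ℝ) (N.ℓ α), HasDerivWithinAt (m α) (m' α y) (Icc 0 (N.ℓ α)) y) ∧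
  (∀ α, ContinuousOn (m' α) (Icc 0 (N.ℓ α))) ∧
  (∀ i : I, ∀ α ∈ N.edges i, ∀ β ∈ N.edges i,
      N.vval m i α / γ i α = N.vval m i β / γ i β) ∧
  (∃ c : A → ℝ,
    (∀ α, ∀ y ∈ Icc (0:ℝ) (N.ℓ α), μ α * m' α y + m α y * Hp α y (v' α y) = c α) ∧
    (∀ i : I, ∑ α ∈ N.edges i, N.sgn i α * c α = 0)) ∧
  (∀ α, ∀ y ∈ Icc (0:ℝ) (N.ℓ α), 0 ≤ m α y) ∧
  (∑ α : A, ∫ y in (0:ℝ)..(N.ℓ α), m α y) = 1 ∧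
  (∑ α : A, ∫ y in (0:ℝ)..(N.ℓ α), v α y) = 0

end Network

namespace Network

theorem hasDerivWithinAt_sq_of_edge {f f' : ℝ → ℝ} {L y : ℝ}
    (hf : HasDerivWithinAt f (f' y) (Icc 0 L) y) :
    HasDerivWithinAt (fun y => f y ^ 2) (2 * (f y * f' y)) (Icc 0 L) y :=
  (hf.pow 2).congr_deriv (by ring)

theorem hasDerivWithinAt_mul_deriv_of_ode {f f' f'' : ℝ → ℝ} {L lam y : ℝ}
    (hf : HasDerivWithinAt f (f' y) (Icc 0 L) y)
    (hf' : HasDerivWithinAt f' (f'' y) (Icc 0 L) y)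
    (hode : -(f'' y) + lam * f y = 0) :
    HasDerivWithinAt (fun y => f y * f' y) (f' y ^ 2 + lam * f y ^ 2) (Icc 0 L) y :=
  (hf.mul hf').congr_deriv (by linear_combination (-f y) * hode)

section Edge

variable {f f' f'' : ℝ → ℝ} {L lam : ℝ} (hL : 0 < L) (hlam : 0 < lam)
  (hf : ∀ y ∈ Icc (0:ℝ) L, HasDerivWithinAt f (f' y) (Icc 0 L) y)
  (hf' : ∀ y ∈ Icc (0:ℝ) L, HasDerivWithinAt f' (f'' y) (Icc 0 L) y)
  (hode : ∀ y ∈ Ioo (0:ℝ) L, -(f'' y) + lam * f y = 0)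

include hf in
theorem continuousOn_sq_edge : ContinuousOn (fun y => f y ^ 2) (Icc 0 L) :=
  fun y hy => (hasDerivWithinAt_sq_of_edge (hf y hy)).continuousWithinAt

include hf hf' in
theorem continuousOn_mul_deriv_edge : ContinuousOn (fun y => f y * f' y) (Icc 0 L) :=
  fun y hy => ((hf y hy).mul (hf' y hy)).continuousWithinAt

include hlam hf hf' hode in
/-- The product `f f'` is nondecreasing along a solution of `f'' = λ f`. -/
theorem monotoneOn_mul_deriv : MonotoneOn (fun y => f y * f' y) (Icc 0 L) := by
  refine monotoneOn_of_hasDerivWithinAt_nonneg (f' := fun y => f' y ^ 2 + lam * f y ^ 2)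
    (convex_Icc 0 L) (continuousOn_mul_deriv_edge hf hf') ?_ ?_
  · intro y hy
    have hy' := interior_subset hy
    rw [interior_Icc] at hy
    exact (hasDerivWithinAt_mul_deriv_of_ode (hf y hy') (hf' y hy') (hode y hy)).mono
      interior_subset
  · intro y _
    positivity

include hlam hf hf' hode in
theorem strictMonoOn_mul_deriv (hne : ∀ y ∈ Icc (0:ℝ) L, f y ≠ 0) :
    StrictMonoOn (fun y => f y * f' y) (Icc 0 L) := by
  refine strictMonoOn_of_hasDerivWithinAt_pos (f' := fun y => f' y ^ 2 + lam * f y ^ 2)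
    (convex_Icc 0 L) (continuousOn_mul_deriv_edge hf hf') ?_ ?_
  · intro y hy
    have hy' := interior_subset hy
    rw [interior_Icc] at hy
    exact (hasDerivWithinAt_mul_deriv_of_ode (hf y hy') (hf' y hy') (hode y hy)).mono
      interior_subset
  · intro y hy
    have := hne y (interior_subset hy)
    positivity

include hf in
theorem monotoneOn_sq_of_mul_deriv_nonneg (h : ∀ y ∈ Icc (0:ℝ) L, 0 ≤ f y * f' y) :
    MonotoneOn (fun y => f y ^ 2) (Icc 0 L) :=
  monotoneOn_of_hasDerivWithinAt_nonneg (f' := fun y => 2 * (f y * f' y))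
    (convex_Icc 0 L) (continuousOn_sq_edge hf)
    (fun y hy => (hasDerivWithinAt_sq_of_edge (hf y (interior_subset hy))).mono interior_subset)
    (fun y hy => mul_nonneg zero_le_two (h y (interior_subset hy)))

include hf in
theorem antitoneOn_sq_of_mul_deriv_nonpos (h : ∀ y ∈ Icc (0:ℝ) L, f y * f' y ≤ 0) :
    AntitoneOn (fun y => f y ^ 2) (Icc 0 L) :=
  antitoneOn_of_hasDerivWithinAt_nonpos (f' := fun y => 2 * (f y * f' y))
    (convex_Icc 0 L) (continuousOn_sq_edge hf)
    (fun y hy => (hasDerivWithinAt_sq_of_edge (hf y (interior_subset hy))).mono interior_subset)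
    (fun y hy => mul_nonpos_of_nonneg_of_nonpos zero_le_two (h y (interior_subset hy)))

include hL hlam hf hf' hode in
/-- Hopf lemma at the left endpoint. -/
theorem mul_deriv_left_neg (h0 : f 0 ≠ 0) (hle : f L ^ 2 ≤ f 0 ^ 2) : f 0 * f' 0 < 0 := by
  by_contra! hp
  have m0 : (0:ℝ) ∈ Icc 0 L := left_mem_Icc.2 hL.le
  have hnn : ∀ y ∈ Icc (0:ℝ) L, 0 ≤ f y * f' y := fun y hy =>
    hp.trans (monotoneOn_mul_deriv hlam hf hf' hode m0 hy hy.1)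
  have hmono := monotoneOn_sq_of_mul_deriv_nonneg hf hnn
  have hne : ∀ y ∈ Icc (0:ℝ) L, f y ≠ 0 := fun y hy =>
    sq_pos_iff.1 ((sq_pos_iff.2 h0).trans_le (hmono m0 hy hy.1))
  have hstrict : StrictMonoOn (fun y => f y ^ 2) (Icc 0 L) := by
    refine strictMonoOn_of_hasDerivWithinAt_pos (f' := fun y => 2 * (f y * f' y))
      (convex_Icc 0 L) (continuousOn_sq_edge hf)
      (fun y hy => (hasDerivWithinAt_sq_of_edge (hf y (interior_subset hy))).mono
        interior_subset) ?_
    intro y hy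
    have hy' := interior_subset hy
    rw [interior_Icc] at hy
    exact mul_pos two_pos
      (hp.trans_lt (strictMonoOn_mul_deriv hlam hf hf' hode hne m0 hy' hy.1))
  exact absurd (hstrict m0 (right_mem_Icc.2 hL.le) hL) (not_lt.2 hle)

include hL hlam hf hf' hode in
/-- Hopf lemma at the right endpoint. -/
theorem mul_deriv_right_pos (h0 : f L ≠ 0) (hle : f 0 ^ 2 ≤ f L ^ 2) : 0 < f L * f' L := by
  by_contra! hp
  have mL : L ∈ Icc 0 L := right_mem_Icc.2 hL.le
  have hnp : ∀ y ∈ Icc (0:ℝ) L, f y * f' y ≤ 0 := fun y hy =>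
    (monotoneOn_mul_deriv hlam hf hf' hode hy mL hy.2).trans hp
  have hanti := antitoneOn_sq_of_mul_deriv_nonpos hf hnp
  have hne : ∀ y ∈ Icc (0:ℝ) L, f y ≠ 0 := fun y hy =>
    sq_pos_iff.1 ((sq_pos_iff.2 h0).trans_le (hanti hy mL hy.2))
  have hstrict : StrictAntiOn (fun y => f y ^ 2) (Icc 0 L) := by
    refine strictAntiOn_of_hasDerivWithinAt_neg (f' := fun y => 2 * (f y * f' y))
      (convex_Icc 0 L) (continuousOn_sq_edge hf)
      (fun y hy => (hasDerivWithinAt_sq_of_edge (hf y (interior_subset hy))).mono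
        interior_subset) ?_
    intro y hy
    have hy' := interior_subset hy
    rw [interior_Icc] at hy
    exact mul_neg_of_pos_of_neg two_pos
      ((strictMonoOn_mul_deriv hlam hf hf' hode hne hy' mL hy.2).trans_le hp)
  exact absurd (hstrict (left_mem_Icc.2 hL.le) mL hL) (not_lt.2 hle)

include hL hlam hf hf' hode in
theorem eq_zero_of_endpoints_eq_zero (h0 : f 0 = 0) (h1 : f L = 0) :
    ∀ y ∈ Icc (0:ℝ) L, f y = 0 := by
  have mL : L ∈ Icc 0 L := right_mem_Icc.2 hL.le
  have hnn : ∀ y ∈ Icc (0:ℝ) L, 0 ≤ f y * f' y := fun y hy => by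
    simpa [h0] using
      monotoneOn_mul_deriv hlam hf hf' hode (left_mem_Icc.2 hL.le) hy hy.1
  intro y hy
  have h := monotoneOn_sq_of_mul_deriv_nonneg hf hnn hy mL hy.2
  simp only [h1] at h
  nlinarith

end Edge

end Network

/-- a `C²` function on the network satisfying `−v'' + λv = 0` on every edge
together with the Kirchhoff conditions at every vertex vanishes identically. -/
theorem stmt_0 {I A : Type} [Fintype I] [Fintype A] [DecidableEq I]
    (N : Network I A) (μ : A → ℝ) (γ : I → A → ℝ)
    (hμ : ∀ α, 0 < μ α) (hγ : ∀ i : I, ∀ α ∈ N.edges i, 0 < γ i α)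
    (lam : ℝ) (hlam : 0 < lam)
    (v v' v'' : A → ℝ → ℝ) (hv : Network.IsC2 N v v' v'')
    (hode : ∀ α : A, ∀ y ∈ Ioo (0:ℝ) (N.ℓ α), -(v'' α y) + lam * v α y = 0)
    (hkir : Network.Kirchhoff N μ γ v') :
    ∀ α : A, ∀ y ∈ Icc (0:ℝ) (N.ℓ α), v α y = 0 := by
  obtain ⟨hd, hd', -, hcont⟩ := hv
  suffices h : ∀ i : I, ∀ α ∈ N.edges i, N.vval v i α = 0 by
    intro α
    refine Network.eq_zero_of_endpoints_eq_zero (N.ℓ_pos α) hlam (hd α) (hd' α) (hode α) ?_ ?_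
    · simpa [Network.vval] using h (N.src α) α (by simp [Network.edges])
    · simpa [Network.vval, N.src_ne_tgt α] using h (N.tgt α) α (by simp [Network.edges])
  by_contra! hcon
  obtain ⟨i₀, α₀, hα₀, hne₀⟩ := hcon
  classical
  -- a vertex value of maximal modulus
  let S : Finset (I × A) := Finset.univ.filter fun p => p.2 ∈ N.edges p.1
  obtain ⟨⟨i, β⟩, hmem, hmax⟩ := S.exists_max_image (fun p => N.vval v p.1 p.2 ^ 2)
    ⟨(i₀, α₀), by simpa [S] using hα₀⟩
  replace hmax : ∀ j : I, ∀ α ∈ N.edges j, N.vval v j α ^ 2 ≤ N.vval v i β ^ 2 :=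
    fun j α hα => hmax (j, α) (by simpa [S] using hα)
  have hβ : β ∈ N.edges i := by simpa [S] using hmem
  have hne : N.vval v i β ≠ 0 :=
    sq_pos_iff.1 ((sq_pos_iff.2 hne₀).trans_le (hmax i₀ α₀ hα₀))
  have hpos : ∀ α ∈ N.edges i, 0 < N.vval v i β * N.oderiv v' i α := by
    intro α hα
    have hs := hmax (N.src α) α (by simp [Network.edges])
    have ht := hmax (N.tgt α) α (by simp [Network.edges])
    rw [← hcont i α hα β hβ] at hne hs ht ⊢
    simp only [Network.vval, N.src_ne_tgt α, if_true, if_false] at hs ht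
    by_cases hi : N.src α = i
    · simp only [Network.vval, Network.oderiv, hi, if_true] at hne hs ht ⊢
      have := Network.mul_deriv_left_neg (N.ℓ_pos α) hlam (hd α) (hd' α) (hode α) hne ht
      linarith
    · simp only [Network.vval, Network.oderiv, hi, if_false] at hne hs ht ⊢
      exact Network.mul_deriv_right_pos (N.ℓ_pos α) hlam (hd α) (hd' α) (hode α) hne hs
  have hsum : 0 < ∑ α ∈ N.edges i, γ i α * μ α * (N.vval v i β * N.oderiv v' i α) :=
    Finset.sum_pos (fun α hα => mul_pos (mul_pos (hγ i α hα) (hμ α)) (hpos α hα)) ⟨β, hβ⟩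
  have hzero : ∑ α ∈ N.edges i, γ i α * μ α * (N.vval v i β * N.oderiv v' i α) = 0 := by
    rw [← mul_zero (N.vval v i β), ← hkir i, Finset.mul_sum]
    exact Finset.sum_congr rfl fun α _ => by ring
  exact hsum.ne' hzero
end

section
/- Let λ > 0 and f ∈ PC(Γ). Then there exists a unique v ∈ C²(Γ) such that −μ_α v_α''(y) + λ v_α(y) = f_α(y) for all y ∈ (0, ℓ_α) and all α ∈ 𝒜, and the Kirchhoff conditions ∑_{α∈𝒜_i} γ_iα μ_α ∂_α v(ν_i) = 0 hold at every vertex ν_i, i ∈ I. -/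
open Set

/-- Maximum principle for a discrete Laplace-type operator with zeroth order term. -/
lemma discrete_maximum_principle {I A : Type} [Fintype I] (E : I → Finset A) (o : I → A → I)
    (w : I → A → ℝ) (C : A → ℝ) (hw : ∀ i, ∀ α ∈ E i, 0 < w i α) (hC : ∀ α, 1 < C α)
    (u : I → ℝ) (hempty : ∀ i, E i = ∅ → u i = 0)
    (hsum : ∀ i, ∑ α ∈ E i, w i α * (C α * u i - u (o i α)) = 0) (i : I) : u i ≤ 0 := by
  have : Nonempty I := ⟨i⟩
  obtain ⟨j, hj⟩ := Finite.exists_max u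
  refine (hj i).trans ?_
  by_contra! hpos
  have hne : (E j).Nonempty := by
    rw [Finset.nonempty_iff_ne_empty]
    intro h
    exact hpos.ne' (hempty j h)
  refine (Finset.sum_pos (fun α hα => mul_pos (hw j α hα) ?_) hne).ne' (hsum j)
  have h1 := hj (o j α)
  nlinarith [hC α]

lemma discrete_uniqueness {I A : Type} [Fintype I] (E : I → Finset A) (o : I → A → I)
    (w : I → A → ℝ) (C : A → ℝ) (hw : ∀ i, ∀ α ∈ E i, 0 < w i α) (hC : ∀ α, 1 < C α)
    (u : I → ℝ) (hempty : ∀ i, E i = ∅ → u i = 0)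
    (hsum : ∀ i, ∑ α ∈ E i, w i α * (C α * u i - u (o i α)) = 0) : u = 0 := by
  ext i
  refine le_antisymm (discrete_maximum_principle E o w C hw hC u hempty hsum i) ?_
  have h := discrete_maximum_principle E o w C hw hC (-u) (fun i hi => by simp [hempty i hi])
    (fun i => ?_) i
  · simpa using h
  · rw [← neg_eq_zero, ← Finset.sum_neg_distrib, ← hsum i]
    refine Finset.sum_congr rfl fun α _ => ?_
    simp only [Pi.neg_apply]
    ring

lemma discrete_existence {I A : Type} [Fintype I] (E : I → Finset A) (o : I → A → I)
    (w : I → A → ℝ) (C : A → ℝ) (hw : ∀ i, ∀ α ∈ E i, 0 < w i α) (hC : ∀ α, 1 < C α)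
    (g : I → ℝ) (hg : ∀ i, E i = ∅ → g i = 0) :
    ∃ u : I → ℝ, ∀ i, ∑ α ∈ E i, w i α * (C α * u i - u (o i α)) = g i := by
  classical
  let T : (I → ℝ) →ₗ[ℝ] (I → ℝ) := LinearMap.pi fun i =>
    (if E i = ∅ then LinearMap.proj i else 0) +
      ∑ α ∈ E i, w i α • (C α • LinearMap.proj i - LinearMap.proj (o i α))
  have hT : ∀ u i, T u i = (if E i = ∅ then u i else 0) +
      ∑ α ∈ E i, w i α * (C α * u i - u (o i α)) := by
    intro u i
    by_cases h : E i = ∅ <;> simp [T, h, LinearMap.sum_apply]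
  have hinj : Function.Injective T := by
    rw [← LinearMap.ker_eq_bot, LinearMap.ker_eq_bot']
    intro u hu
    have hu' : ∀ i, T u i = 0 := fun i => by rw [hu]; rfl
    have hempty : ∀ i, E i = ∅ → u i = 0 := fun i hi => by
      have := hu' i
      rw [hT] at this
      simpa [hi] using this
    refine discrete_uniqueness E o w C hw hC u hempty fun i => ?_
    have := hu' i
    rw [hT] at this
    split_ifs at this with h
    · simp [h]
    · simpa using this
  obtain ⟨u, hu⟩ := (LinearMap.injective_iff_surjective.mp hinj) g
  refine ⟨u, fun i => ?_⟩
  have := hT u i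
  rw [hu] at this
  split_ifs at this with h
  · simp [h, hg]
  · simpa using this.symm

lemma hasDerivAt_sinh_mul (k y : ℝ) :
    HasDerivAt (fun y => Real.sinh (k * y)) (k * Real.cosh (k * y)) y := by
  simpa [mul_comm] using ((hasDerivAt_id y).const_mul k).sinh

lemma hasDerivAt_cosh_mul (k y : ℝ) :
    HasDerivAt (fun y => Real.cosh (k * y)) (k * Real.sinh (k * y)) y := by
  simpa [mul_comm] using ((hasDerivAt_id y).const_mul k).cosh

lemma eq_left_of_hasDerivWithinAt_zero {L : ℝ} {F : ℝ → ℝ}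
    (hF : ∀ y ∈ Icc (0:ℝ) L, HasDerivWithinAt F 0 (Icc 0 L) y) :
    ∀ y ∈ Icc (0:ℝ) L, F y = F 0 :=
  constant_of_has_deriv_right_zero (fun y hy => (hF y hy).continuousWithinAt) fun y hy =>
    (hF y (Ico_subset_Icc_self hy)).mono_of_mem_nhdsWithin (Icc_mem_nhdsGE_of_mem hy)

/-- Solutions of `z'' = k² z` are determined by their Cauchy data at `0`. -/
lemma homogeneous_representation {k L : ℝ} {z z' z'' : ℝ → ℝ}
    (h1 : ∀ y ∈ Icc (0:ℝ) L, HasDerivWithinAt z (z' y) (Icc 0 L) y)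
    (h2 : ∀ y ∈ Icc (0:ℝ) L, HasDerivWithinAt z' (z'' y) (Icc 0 L) y)
    (h3 : ∀ y ∈ Icc (0:ℝ) L, z'' y = k ^ 2 * z y) {y : ℝ} (hy : y ∈ Icc (0:ℝ) L) :
    k * z y = k * z 0 * Real.cosh (k * y) + z' 0 * Real.sinh (k * y) ∧
      z' y = z' 0 * Real.cosh (k * y) + k * z 0 * Real.sinh (k * y) := by
  have hA := eq_left_of_hasDerivWithinAt_zero
    (F := fun y => z' y * Real.sinh (k * y) - k * z y * Real.cosh (k * y)) (L := L)
    (fun y hy => by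
      refine (((h2 y hy).mul (hasDerivAt_sinh_mul k y).hasDerivWithinAt).sub
        (((h1 y hy).const_mul k).mul
          (hasDerivAt_cosh_mul k y).hasDerivWithinAt)).congr_deriv ?_
      rw [h3 y hy]; ring) y hy
  have hB := eq_left_of_hasDerivWithinAt_zero
    (F := fun y => z' y * Real.cosh (k * y) - k * z y * Real.sinh (k * y)) (L := L)
    (fun y hy => by
      refine (((h2 y hy).mul (hasDerivAt_cosh_mul k y).hasDerivWithinAt).sub
        (((h1 y hy).const_mul k).mul
          (hasDerivAt_sinh_mul k y).hasDerivWithinAt)).congr_deriv ?_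
      rw [h3 y hy]; ring) y hy
  simp only [mul_zero, Real.sinh_zero, Real.cosh_zero, mul_one, sub_zero, zero_sub] at hA hB
  have hcs := Real.cosh_sq (k * y)
  constructor
  · linear_combination Real.sinh (k * y) * hB - Real.cosh (k * y) * hA - k * z y * hcs
  · linear_combination Real.cosh (k * y) * hB - Real.sinh (k * y) * hA - z' y * hcs

/-- The Dirichlet-to-Neumann map of `z'' = k² z` on `[0, L]`. -/
lemma homogeneous_dirichlet_to_neumann {k L : ℝ} (hk : 0 < k) (hL : 0 < L) {z z' z'' : ℝ → ℝ}
    (h1 : ∀ y ∈ Icc (0:ℝ) L, HasDerivWithinAt z (z' y) (Icc 0 L) y)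
    (h2 : ∀ y ∈ Icc (0:ℝ) L, HasDerivWithinAt z' (z'' y) (Icc 0 L) y)
    (h3 : ∀ y ∈ Icc (0:ℝ) L, z'' y = k ^ 2 * z y) :
    -(z' 0) = k / Real.sinh (k * L) * (Real.cosh (k * L) * z 0 - z L) ∧
      z' L = k / Real.sinh (k * L) * (Real.cosh (k * L) * z L - z 0) := by
  have hS : 0 < Real.sinh (k * L) := Real.sinh_pos_iff.mpr (mul_pos hk hL)
  obtain ⟨ha, hb⟩ := homogeneous_representation h1 h2 h3 (right_mem_Icc.mpr hL.le)
  have hcs := Real.cosh_sq (k * L)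
  constructor
  · rw [div_mul_eq_mul_div, eq_div_iff hS.ne']
    linear_combination ha
  · rw [div_mul_eq_mul_div, eq_div_iff hS.ne']
    linear_combination Real.sinh (k * L) * hb - Real.cosh (k * L) * ha - k * z 0 * hcs

lemma homogeneous_dirichlet_unique {k L : ℝ} (hk : 0 < k) (hL : 0 < L) {z z' z'' : ℝ → ℝ}
    (h1 : ∀ y ∈ Icc (0:ℝ) L, HasDerivWithinAt z (z' y) (Icc 0 L) y)
    (h2 : ∀ y ∈ Icc (0:ℝ) L, HasDerivWithinAt z' (z'' y) (Icc 0 L) y)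
    (h3 : ∀ y ∈ Icc (0:ℝ) L, z'' y = k ^ 2 * z y) (h0 : z 0 = 0) (hzL : z L = 0) :
    ∀ y ∈ Icc (0:ℝ) L, z y = 0 := by
  intro y hy
  have hz' : z' 0 = 0 := by
    simpa [h0, hzL] using (homogeneous_dirichlet_to_neumann hk hL h1 h2 h3).1
  simpa [h0, hz', hk.ne'] using (homogeneous_representation h1 h2 h3 hy).1

lemma exists_particular_solution (k : ℝ) (hk : k ≠ 0) (g : ℝ → ℝ) (hg : Continuous g) :
    ∃ p p' : ℝ → ℝ, p 0 = 0 ∧ p' 0 = 0 ∧ (∀ y, HasDerivAt p (p' y) y) ∧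
      ∀ y, HasDerivAt p' (k ^ 2 * p y - g y) y := by
  have hc : ∀ y, HasDerivAt (fun y => ∫ s in (0:ℝ)..y, Real.cosh (k * s) * g s)
      (Real.cosh (k * y) * g y) y := fun y =>
    (by fun_prop : Continuous _).integral_hasStrictDerivAt 0 y |>.hasDerivAt
  have hs : ∀ y, HasDerivAt (fun y => ∫ s in (0:ℝ)..y, Real.sinh (k * s) * g s)
      (Real.sinh (k * y) * g y) y := fun y =>
    (by fun_prop : Continuous _).integral_hasStrictDerivAt 0 y |>.hasDerivAt
  refine ⟨fun y => -(1 / k) * (Real.sinh (k * y) * (∫ s in (0:ℝ)..y, Real.cosh (k * s) * g s) -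
      Real.cosh (k * y) * ∫ s in (0:ℝ)..y, Real.sinh (k * s) * g s),
    fun y => -(Real.cosh (k * y) * (∫ s in (0:ℝ)..y, Real.cosh (k * s) * g s) -
      Real.sinh (k * y) * ∫ s in (0:ℝ)..y, Real.sinh (k * s) * g s),
    by simp, by simp, fun y => ?_, fun y => ?_⟩
  · refine ((((hasDerivAt_sinh_mul k y).mul (hc y)).sub
      ((hasDerivAt_cosh_mul k y).mul (hs y))).const_mul (-(1 / k))).congr_deriv ?_
    field_simp
    ring
  · refine (((hasDerivAt_cosh_mul k y).mul (hc y)).sub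
      ((hasDerivAt_sinh_mul k y).mul (hs y))).neg.congr_deriv ?_
    field_simp
    linear_combination -g y * Real.cosh_sq (k * y)

/-- Solvability of the Dirichlet problem for `v'' = k² v - h` on `[0, L]`, with the resulting
affine Dirichlet-to-Neumann map. -/
lemma exists_dirichlet_solution {k L : ℝ} (hk : 0 < k) (hL : 0 < L) {h : ℝ → ℝ}
    (hh : ContinuousOn h (Icc 0 L)) :
    ∃ r₀ r₁ : ℝ, ∀ a b : ℝ, ∃ v v' : ℝ → ℝ,
      (∀ y ∈ Icc (0:ℝ) L, HasDerivWithinAt v (v' y) (Icc 0 L) y) ∧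
      (∀ y ∈ Icc (0:ℝ) L, HasDerivWithinAt v' (k ^ 2 * v y - h y) (Icc 0 L) y) ∧
      v 0 = a ∧ v L = b ∧
      -(v' 0) = k / Real.sinh (k * L) * (Real.cosh (k * L) * a - b) + r₀ ∧
      v' L = k / Real.sinh (k * L) * (Real.cosh (k * L) * b - a) + r₁ := by
  have hS : 0 < Real.sinh (k * L) := Real.sinh_pos_iff.mpr (mul_pos hk hL)
  have hg : Continuous (IccExtend hL.le ((Icc 0 L).domRestrict h)) :=
    (continuousOn_iff_continuous_domRestrict.mp hh).Icc_extend'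
  obtain ⟨p, p', hp0, hp0', hp, hp'⟩ := exists_particular_solution k hk.ne' _ hg
  refine ⟨k * p L / Real.sinh (k * L),
    p' L - k * p L * Real.cosh (k * L) / Real.sinh (k * L), fun a b => ?_⟩
  obtain ⟨c, hc⟩ : ∃ c, c * Real.sinh (k * L) = b - p L - a * Real.cosh (k * L) :=
    ⟨_, div_mul_cancel₀ _ hS.ne'⟩
  refine ⟨fun y => p y + a * Real.cosh (k * y) + c * Real.sinh (k * y),
    fun y => p' y + a * (k * Real.sinh (k * y)) + c * (k * Real.cosh (k * y)),
    fun y _ => ?_, fun y hy => ?_, by simp [hp0], by linear_combination hc, ?_, ?_⟩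
  · exact (((hp y).add ((hasDerivAt_cosh_mul k y).const_mul a)).add
      ((hasDerivAt_sinh_mul k y).const_mul c)).hasDerivWithinAt
  · refine ((((hp' y).add (((hasDerivAt_sinh_mul k y).const_mul k).const_mul a)).add
      (((hasDerivAt_cosh_mul k y).const_mul k).const_mul c)).hasDerivWithinAt).congr_deriv ?_
    rw [IccExtend_of_mem _ _ hy, domRestrict_apply]
    ring
  · simp only [hp0', mul_zero, Real.sinh_zero, Real.cosh_zero]
    field_simp
    linear_combination -k * hc
  · have hcs := Real.cosh_sq (k * L)
    field_simp
    linear_combination k * Real.cosh (k * L) * hc - k * a * hcs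

/-- An identity between functions continuous on `[0, L]` extends from the open interval. -/
lemma eqOn_Icc_of_eqOn_Ioo {L : ℝ} (hL : 0 < L) {F G : ℝ → ℝ} (hF : ContinuousOn F (Icc 0 L))
    (hG : ContinuousOn G (Icc 0 L)) (h : EqOn F G (Ioo 0 L)) : EqOn F G (Icc 0 L) :=
  h.of_subset_closure hF hG Ioo_subset_Icc_self (closure_Ioo hL.ne).ge

namespace Network

variable {I A : Type} [Fintype I] [Fintype A] [DecidableEq I]

/-- The endpoint of `α` different from `i`. -/
def opposite (N : Network I A) (i : I) (α : A) : I :=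
  if N.src α = i then N.tgt α else N.src α

lemma mem_edges {N : Network I A} {i : I} {α : A} :
    α ∈ N.edges i ↔ N.src α = i ∨ N.tgt α = i := by
  simp [edges]

/-- A function on the network which solves `z'' = k² z` on every edge, is continuous at the
vertices and satisfies the Kirchhoff conditions vanishes identically. -/
lemma homogeneous_unique (N : Network I A) (μ : A → ℝ) (γ : I → A → ℝ)
    (hμ : ∀ α, 0 < μ α) (hγ : ∀ i : I, ∀ α ∈ N.edges i, 0 < γ i α)
    (k : A → ℝ) (hk : ∀ α, 0 < k α) {z z' z'' : A → ℝ → ℝ} (hz : N.IsC2 z z' z'')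
    (heq : ∀ α, ∀ y ∈ Icc (0:ℝ) (N.ℓ α), z'' α y = k α ^ 2 * z α y)
    (hK : N.Kirchhoff μ γ z') :
    ∀ α, ∀ y ∈ Icc (0:ℝ) (N.ℓ α), z α y = 0 := by
  classical
  obtain ⟨h1, h2, -, h4⟩ := hz
  obtain ⟨u, hu, hempty⟩ : ∃ u : I → ℝ, (∀ i, ∀ α ∈ N.edges i, N.vval z i α = u i) ∧
      ∀ i, N.edges i = ∅ → u i = 0 := by
    refine ⟨fun i => if h : (N.edges i).Nonempty then N.vval z i h.choose else 0, ?_, ?_⟩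
    · intro i α hα
      have h : (N.edges i).Nonempty := ⟨α, hα⟩
      simp only [h, dif_pos]
      exact h4 i α hα _ h.choose_spec
    · intro i hi
      simp [hi]
  have hsrc : ∀ α, z α 0 = u (N.src α) := fun α => by
    simpa [vval] using hu (N.src α) α (mem_edges.mpr (Or.inl rfl))
  have htgt : ∀ α, z α (N.ℓ α) = u (N.tgt α) := fun α => by
    simpa [vval, N.src_ne_tgt α] using hu (N.tgt α) α (mem_edges.mpr (Or.inr rfl))
  have hpos : ∀ α, 0 < k α * N.ℓ α := fun α => mul_pos (hk α) (N.ℓ_pos α)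
  have hu0 : u = 0 := by
    refine discrete_uniqueness N.edges N.opposite
      (fun i α => γ i α * μ α * (k α / Real.sinh (k α * N.ℓ α)))
      (fun α => Real.cosh (k α * N.ℓ α))
      (fun i α hα => mul_pos (mul_pos (hγ i α hα) (hμ α))
        (div_pos (hk α) (Real.sinh_pos_iff.mpr (hpos α))))
      (fun α => Real.one_lt_cosh.mpr (hpos α).ne') u hempty fun i => ?_
    rw [← hK i]
    refine Finset.sum_congr rfl fun α hα => ?_
    obtain ⟨hD0, hD1⟩ :=
      homogeneous_dirichlet_to_neumann (hk α) (N.ℓ_pos α) (h1 α) (h2 α) (heq α)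
    rw [mul_assoc]
    congr 1
    by_cases hs : N.src α = i
    · simp only [oderiv, opposite, hs, if_true, hD0, hsrc, htgt]
    · have ht : N.tgt α = i := (mem_edges.mp hα).resolve_left hs
      simp only [oderiv, opposite, hs, if_false, hD1, hsrc, htgt, ht]
  intro α
  exact homogeneous_dirichlet_unique (hk α) (N.ℓ_pos α) (h1 α) (h2 α) (heq α)
    (by rw [hsrc, hu0]; rfl) (by rw [htgt, hu0]; rfl)

/-- Existence for `v'' = k² v - h` with Kirchhoff conditions. -/
lemma exists_solution (N : Network I A) (μ : A → ℝ) (γ : I → A → ℝ)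
    (hμ : ∀ α, 0 < μ α) (hγ : ∀ i : I, ∀ α ∈ N.edges i, 0 < γ i α)
    (k : A → ℝ) (hk : ∀ α, 0 < k α) (h : A → ℝ → ℝ)
    (hh : ∀ α, ContinuousOn (h α) (Icc (0:ℝ) (N.ℓ α))) :
    ∃ v v' : A → ℝ → ℝ, N.IsC2 v v' (fun α y => k α ^ 2 * v α y - h α y) ∧
      N.Kirchhoff μ γ v' := by
  choose r₀ r₁ hr using fun α => exists_dirichlet_solution (hk α) (N.ℓ_pos α) (hh α)
  have hpos : ∀ α, 0 < k α * N.ℓ α := fun α => mul_pos (hk α) (N.ℓ_pos α)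
  obtain ⟨u, hu⟩ := discrete_existence N.edges N.opposite
    (fun i α => γ i α * μ α * (k α / Real.sinh (k α * N.ℓ α)))
    (fun α => Real.cosh (k α * N.ℓ α))
    (fun i α hα => mul_pos (mul_pos (hγ i α hα) (hμ α))
      (div_pos (hk α) (Real.sinh_pos_iff.mpr (hpos α))))
    (fun α => Real.one_lt_cosh.mpr (hpos α).ne')
    (fun i => -∑ α ∈ N.edges i, γ i α * μ α * (if N.src α = i then r₀ α else r₁ α))
    (fun i hi => by simp [hi])
  choose v v' h1 h2 hsrc htgt hD0 hD1 using fun α => hr α (u (N.src α)) (u (N.tgt α))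
  have hval : ∀ i, ∀ α ∈ N.edges i, N.vval v i α = u i := by
    intro i α hα
    by_cases hs : N.src α = i
    · simp [vval, hsrc, hs]
    · simp [vval, htgt, hs, (mem_edges.mp hα).resolve_left hs]
  refine ⟨v, v', ⟨h1, h2, fun α => ?_, fun i α hα β hβ => ?_⟩, fun i => ?_⟩
  · exact (continuousOn_const.mul fun y hy => (h1 α y hy).continuousWithinAt).sub (hh α)
  · rw [hval i α hα, hval i β hβ]
  · have hi := hu i
    rw [eq_neg_iff_add_eq_zero, ← Finset.sum_add_distrib] at hi
    rw [← hi]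
    refine Finset.sum_congr rfl fun α hα => ?_
    rw [mul_assoc _ (k α / _), ← mul_add]
    congr 1
    by_cases hs : N.src α = i
    · simp only [oderiv, opposite, hs, if_true, hD0]
    · have ht : N.tgt α = i := (mem_edges.mp hα).resolve_left hs
      simp only [oderiv, opposite, hs, if_false, hD1, ht]

lemma IsC2.sub {N : Network I A} {v v' v'' w w' w'' : A → ℝ → ℝ} (hw : N.IsC2 w w' w'')
    (hv : N.IsC2 v v' v'') : N.IsC2 (w - v) (w' - v') (w'' - v'') := by
  refine ⟨fun α y hy => (hw.1 α y hy).sub (hv.1 α y hy),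
    fun α y hy => (hw.2.1 α y hy).sub (hv.2.1 α y hy),
    fun α => (hw.2.2.1 α).sub (hv.2.2.1 α), fun i α hα β hβ => ?_⟩
  have hsub : ∀ δ, N.vval (w - v) i δ = N.vval w i δ - N.vval v i δ := fun δ => by
    unfold vval
    split_ifs <;> rfl
  rw [hsub, hsub, hw.2.2.2 i α hα β hβ, hv.2.2.2 i α hα β hβ]

lemma Kirchhoff.sub {N : Network I A} {μ : A → ℝ} {γ : I → A → ℝ} {v' w' : A → ℝ → ℝ}
    (hw : N.Kirchhoff μ γ w') (hv : N.Kirchhoff μ γ v') : N.Kirchhoff μ γ (w' - v') := by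
  intro i
  have h := congrArg₂ (· - ·) (hw i) (hv i)
  simp only [← Finset.sum_sub_distrib, sub_zero] at h
  rw [← h]
  refine Finset.sum_congr rfl fun α _ => ?_
  unfold oderiv
  split_ifs <;> simp only [Pi.sub_apply] <;> ring

end Network


/-- existence and uniqueness of the classical solution of
`−μ_α v'' + λ v = f` on the network with Kirchhoff conditions. -/
theorem stmt_2 {I A : Type} [Fintype I] [Fintype A] [DecidableEq I]
    (N : Network I A) (μ : A → ℝ) (γ : I → A → ℝ)
    (hμ : ∀ α, 0 < μ α) (hγ : ∀ i : I, ∀ α ∈ N.edges i, 0 < γ i α)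
    (lam : ℝ) (hlam : 0 < lam)
    (f : A → ℝ → ℝ) (hf : ∀ α, ContinuousOn (f α) (Icc (0:ℝ) (N.ℓ α))) :
    ∃ v v' v'' : A → ℝ → ℝ,
      (Network.IsC2 N v v' v'' ∧
        (∀ α : A, ∀ y ∈ Ioo (0:ℝ) (N.ℓ α), -(μ α * v'' α y) + lam * v α y = f α y) ∧
        Network.Kirchhoff N μ γ v') ∧
      ∀ w w' w'' : A → ℝ → ℝ,
        Network.IsC2 N w w' w'' →
        (∀ α : A, ∀ y ∈ Ioo (0:ℝ) (N.ℓ α), -(μ α * w'' α y) + lam * w α y = f α y) →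
        Network.Kirchhoff N μ γ w' →
        ∀ α : A, ∀ y ∈ Icc (0:ℝ) (N.ℓ α), w α y = v α y := by
  have hk : ∀ α, 0 < Real.sqrt (lam / μ α) := fun α => Real.sqrt_pos.mpr (div_pos hlam (hμ α))
  have hk2 : ∀ α, Real.sqrt (lam / μ α) ^ 2 = lam / μ α := fun α =>
    Real.sq_sqrt (div_pos hlam (hμ α)).le
  obtain ⟨v, v', hv, hvK⟩ := N.exists_solution μ γ hμ hγ _ hk (fun α y => f α y / μ α)
    fun α => (hf α).div_const _
  refine ⟨v, v', _, ⟨hv, fun α y _ => ?_, hvK⟩, fun w w' w'' hw hwf hwK α y hy => ?_⟩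
  · have := (hμ α).ne'
    simp only [hk2]
    field_simp
    ring
  · refine sub_eq_zero.mp (N.homogeneous_unique μ γ hμ hγ _ hk (hw.sub hv) ?_ (hwK.sub hvK) α y hy)
    intro β x hx
    have hcont : ContinuousOn (w β) (Icc 0 (N.ℓ β)) := fun y hy =>
      (hw.1 β y hy).continuousWithinAt
    have h := eqOn_Icc_of_eqOn_Ioo (N.ℓ_pos β)
      ((continuousOn_const.mul (hw.2.2.1 β)).neg.add (continuousOn_const.mul hcont))
      (hf β) (hwf β) hx
    have hμβ := (hμ β).ne'
    simp only [Pi.sub_apply, hk2, Pi.add_apply, Pi.neg_apply, Pi.mul_apply] at h ⊢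
    field_simp
    linear_combination -h
end

section
/- Let b ∈ PC(Γ). Suppose v ∈ C²(Γ) satisfies: (i) −μ_α v_α''(y) + b_α(y) v_α'(y) = 0 for all y ∈ (0, ℓ_α) and all α ∈ 𝒜; and (ii) the Kirchhoff conditions ∑_{α∈𝒜_i} γ_iα μ_α ∂_α v(ν_i) = 0 for every vertex ν_i, i ∈ I. Then v is constant on Γ, i.e. there is a real number κ with v_α ≡ κ on [0, ℓ_α] for every α ∈ 𝒜. -/
open Set

theorem eq_left_of_hasDerivAt_zero {f : ℝ → ℝ} {a b : ℝ} (hf : ContinuousOn f (Icc a b))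
    (hf' : ∀ x ∈ Ioo a b, HasDerivAt f 0 x) {y : ℝ} (hy : y ∈ Icc a b) : f y = f a := by
  rcases hy.1.eq_or_lt with rfl | hay
  · rfl
  obtain ⟨c, -, hc⟩ := exists_hasDerivAt_eq_slope f (fun _ => 0) hay
    (hf.mono (Icc_subset_Icc_right hy.2)) fun x hx => hf' x ⟨hx.1, hx.2.trans_le hy.2⟩
  have hne : y - a ≠ 0 := (sub_pos.2 hay).ne'
  rw [eq_comm, div_eq_zero_iff] at hc
  exact sub_eq_zero.1 (hc.resolve_right hne)

/-- A solution of the linear equation `g' = c g` is its initial value times a positive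
continuous function. -/
theorem exists_pos_factor_of_linear_ode {c g : ℝ → ℝ} {l : ℝ} (hl : 0 ≤ l)
    (hc : ContinuousOn c (Icc 0 l)) (hg : ContinuousOn g (Icc 0 l))
    (hg' : ∀ y ∈ Ioo 0 l, HasDerivAt g (c y * g y) y) :
    ∃ E : ℝ → ℝ, Continuous E ∧ (∀ y, 0 < E y) ∧ ∀ y ∈ Icc 0 l, g y = g 0 * E y := by
  set C : ℝ → ℝ := IccExtend hl (domRestrict (Icc 0 l) c)
  have hC : Continuous C := (continuousOn_iff_continuous_domRestrict.1 hc).Icc_extend'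
  have hCc : ∀ y ∈ Icc 0 l, C y = c y := fun y hy => IccExtend_of_mem hl _ hy
  set B : ℝ → ℝ := fun y => ∫ t in (0:ℝ)..y, C t
  have hB : ∀ y, HasDerivAt B (C y) y := fun y => hC.integral_hasStrictDerivAt 0 y |>.hasDerivAt
  have hBc : Continuous B := continuous_iff_continuousAt.2 fun y => (hB y).continuousAt
  refine ⟨fun y => Real.exp (B y), by fun_prop, fun y => Real.exp_pos _, fun y hy => ?_⟩
  have key := eq_left_of_hasDerivAt_zero (f := fun y => g y * Real.exp (-B y))
    (hg.mul (by fun_prop)) (fun x hx => by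
      have h := (hg' x hx).mul (hB x).neg.exp
      rw [hCc x (Ioo_subset_Icc_self hx)] at h
      exact h.congr_deriv (by ring)) hy
  have hB0 : B 0 = 0 := intervalIntegral.integral_same
  simp only [hB0, neg_zero, Real.exp_zero, mul_one] at key
  rw [← key, mul_assoc, ← Real.exp_add, neg_add_cancel, Real.exp_zero, mul_one]

/-- If `f'` solves a linear first order equation, then both `f'` and the increments of `f`
are multiples of `f' 0`, with positive factors. -/
theorem exists_pos_factors_of_second_order_ode {c f f' : ℝ → ℝ} {l : ℝ} (hl : 0 < l)
    (hc : ContinuousOn c (Icc 0 l)) (hf : ContinuousOn f (Icc 0 l))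
    (hf' : ContinuousOn f' (Icc 0 l)) (hder : ∀ y ∈ Ioo 0 l, HasDerivAt f (f' y) y)
    (hder' : ∀ y ∈ Ioo 0 l, HasDerivAt f' (c y * f' y) y) :
    ∃ E D : ℝ → ℝ, 0 < E l ∧ 0 < D l ∧ f' l = f' 0 * E l ∧
      ∀ y ∈ Icc 0 l, f y = f 0 + f' 0 * D y := by
  obtain ⟨E, hE, hpos, hfac⟩ := exists_pos_factor_of_linear_ode hl.le hc hf' hder'
  set D : ℝ → ℝ := fun y => ∫ t in (0:ℝ)..y, E t
  have hD : ∀ y, HasDerivAt D (E y) y := fun y => hE.integral_hasStrictDerivAt 0 y |>.hasDerivAt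
  have hDc : Continuous D := continuous_iff_continuousAt.2 fun y => (hD y).continuousAt
  refine ⟨E, D, hpos l, intervalIntegral.intervalIntegral_pos_of_pos
    (hE.intervalIntegrable 0 l) hpos hl, hfac l (right_mem_Icc.2 hl.le), fun y hy => ?_⟩
  have key := eq_left_of_hasDerivAt_zero (f := fun y => f y - f' 0 * D y)
    (hf.sub (by fun_prop)) (fun x hx => by
      refine ((hder x hx).sub ((hD x).const_mul (f' 0))).congr_deriv ?_
      rw [hfac x (Ioo_subset_Icc_self hx), sub_self]) hy
  have hD0 : D 0 = 0 := intervalIntegral.integral_same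
  simp only [hD0, mul_zero, sub_zero] at key
  linarith

namespace Network

variable {I A : Type} [Fintype I] [Fintype A] [DecidableEq I]

theorem src_mem_edges (N : Network I A) (α : A) : α ∈ N.edges (N.src α) := by
  simp [edges]

theorem tgt_mem_edges (N : Network I A) (α : A) : α ∈ N.edges (N.tgt α) := by
  simp [edges]

theorem vval_src (N : Network I A) (f : A → ℝ → ℝ) (α : A) :
    N.vval f (N.src α) α = f α 0 := by
  simp [vval]

theorem vval_tgt (N : Network I A) (f : A → ℝ → ℝ) (α : A) :
    N.vval f (N.tgt α) α = f α (N.ℓ α) := by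
  simp [vval, N.src_ne_tgt α]

theorem oderiv_src (N : Network I A) (f : A → ℝ → ℝ) (α : A) :
    N.oderiv f (N.src α) α = -f α 0 := by
  simp [oderiv]

theorem oderiv_tgt (N : Network I A) (f : A → ℝ → ℝ) (α : A) :
    N.oderiv f (N.tgt α) α = f α (N.ℓ α) := by
  simp [oderiv, N.src_ne_tgt α]

/-- Strong maximum principle at a vertex: at a vertex where the maximum `M` is attained, the
Kirchhoff condition forces the derivative to vanish along every incident edge. -/
theorem deriv_eq_zero_of_vval_eq_max (N : Network I A) {μ : A → ℝ} {γ : I → A → ℝ}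
    (hμ : ∀ α, 0 < μ α) (hγ : ∀ i : I, ∀ α ∈ N.edges i, 0 < γ i α)
    {v v' : A → ℝ → ℝ} (hkir : N.Kirchhoff μ γ v') {E D : A → ℝ}
    (hE : ∀ α, 0 < E α) (hD : ∀ α, 0 < D α)
    (hEv : ∀ α, v' α (N.ℓ α) = v' α 0 * E α)
    (hDv : ∀ α, v α (N.ℓ α) = v α 0 + v' α 0 * D α)
    {M : ℝ} (hM₀ : ∀ α, v α 0 ≤ M) (hMℓ : ∀ α, v α (N.ℓ α) ≤ M)
    {i : I} (hi : ∀ α ∈ N.edges i, N.vval v i α = M) {α : A} (hα : α ∈ N.edges i) :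
    v' α 0 = 0 := by
  have hout : ∀ β ∈ N.edges i, 0 ≤ N.oderiv v' i β := by
    intro β hβ
    have hiβ := hi β hβ
    have hβ' : N.src β = i ∨ N.tgt β = i := by simpa [edges] using hβ
    rcases hβ' with rfl | rfl
    · rw [vval_src] at hiβ
      rw [oderiv_src, neg_nonneg]
      exact nonpos_of_mul_nonpos_left (by linarith [hDv β, hMℓ β]) (hD β)
    · rw [vval_tgt] at hiβ
      rw [oderiv_tgt, hEv]
      exact mul_nonneg (nonneg_of_mul_nonneg_left (by linarith [hDv β, hM₀ β]) (hD β)) (hE β).le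
  have hzero := (Finset.sum_eq_zero_iff_of_nonneg fun β hβ =>
    mul_nonneg (mul_pos (hγ i β hβ) (hμ β)).le (hout β hβ)).1 (hkir i) α hα
  have ho : N.oderiv v' i α = 0 :=
    (mul_eq_zero.1 hzero).resolve_left (mul_pos (hγ i α hα) (hμ α)).ne'
  have hα' : N.src α = i ∨ N.tgt α = i := by simpa [edges] using hα
  rcases hα' with rfl | rfl
  · rwa [oderiv_src, neg_eq_zero] at ho
  · rw [oderiv_tgt, hEv] at ho
    exact (mul_eq_zero.1 ho).resolve_right (hE α).ne'

end Network


/-- a `C²` solution of the Kolmogorov equation `−μ_α v'' + b v' = 0` on the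
network with Kirchhoff conditions is constant. -/
theorem stmt_3 {I A : Type} [Fintype I] [Fintype A] [DecidableEq I]
    (N : Network I A) (μ : A → ℝ) (γ : I → A → ℝ)
    (hμ : ∀ α, 0 < μ α) (hγ : ∀ i : I, ∀ α ∈ N.edges i, 0 < γ i α)
    (b : A → ℝ → ℝ) (hb : ∀ α, ContinuousOn (b α) (Icc (0:ℝ) (N.ℓ α)))
    (v v' v'' : A → ℝ → ℝ) (hv : Network.IsC2 N v v' v'')
    (hode : ∀ α : A, ∀ y ∈ Ioo (0:ℝ) (N.ℓ α), -(μ α * v'' α y) + b α y * v' α y = 0)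
    (hkir : Network.Kirchhoff N μ γ v') :
    ∃ κ : ℝ, ∀ α : A, ∀ y ∈ Icc (0:ℝ) (N.ℓ α), v α y = κ := by
  obtain ⟨hv1, hv2, -, hcont⟩ := hv
  rcases isEmpty_or_nonempty A with hA | hA
  · exact ⟨0, fun α => hA.elim α⟩
  have hfactors := fun α => exists_pos_factors_of_second_order_ode (c := fun y => b α y / μ α)
    (N.ℓ_pos α) ((hb α).div_const _) (fun y hy => (hv1 α y hy).continuousWithinAt)
    (fun y hy => (hv2 α y hy).continuousWithinAt)
    (fun y hy => (hv1 α y (Ioo_subset_Icc_self hy)).hasDerivAt (Icc_mem_nhds hy.1 hy.2))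
    (fun y hy => by
      refine ((hv2 α y (Ioo_subset_Icc_self hy)).hasDerivAt
        (Icc_mem_nhds hy.1 hy.2)).congr_deriv ?_
      have := (hμ α).ne'
      field_simp
      linarith [hode α y hy])
  choose E D hE hD hEv hDv using hfactors
  have hDℓ := fun α => hDv α (N.ℓ α) (right_mem_Icc.2 (N.ℓ_pos α).le)
  obtain ⟨α₀, hα₀⟩ := Finite.exists_max fun α => max (v α 0) (v α (N.ℓ α))
  set M := max (v α₀ 0) (v α₀ (N.ℓ α₀)) with hM
  have hM₀ : ∀ α, v α 0 ≤ M := fun α => (le_max_left _ _).trans (hα₀ α)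
  have hMℓ : ∀ α, v α (N.ℓ α) ≤ M := fun α => (le_max_right _ _).trans (hα₀ α)
  have hzero : ∀ i, (∀ α ∈ N.edges i, N.vval v i α = M) → ∀ α ∈ N.edges i, v' α 0 = 0 :=
    fun i hi α hα => N.deriv_eq_zero_of_vval_eq_max hμ hγ hkir hE hD hEv hDℓ hM₀ hMℓ hi hα
  obtain ⟨i₀, hi₀⟩ : ∃ i, ∀ α ∈ N.edges i, N.vval v i α = M := by
    rcases max_choice (v α₀ 0) (v α₀ (N.ℓ α₀)) with h | h
    · refine ⟨N.src α₀, fun α hα => ?_⟩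
      rw [hcont _ α hα α₀ (N.src_mem_edges α₀), N.vval_src, hM, h]
    · refine ⟨N.tgt α₀, fun α hα => ?_⟩
      rw [hcont _ α hα α₀ (N.tgt_mem_edges α₀), N.vval_tgt, hM, h]
  have hall : ∀ i, ∀ α ∈ N.edges i, N.vval v i α = M := by
    intro i
    induction N.connected i₀ i with
    | refl => exact hi₀
    | tail _ hstep ih =>
      obtain ⟨β, ⟨rfl, rfl⟩ | ⟨rfl, rfl⟩⟩ := hstep
      · intro α hα
        have h0 := hzero _ ih β (N.src_mem_edges β)
        have hβ := ih β (N.src_mem_edges β)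
        rw [N.vval_src] at hβ
        rw [hcont _ α hα β (N.tgt_mem_edges β), N.vval_tgt, hDℓ, h0, hβ, zero_mul, add_zero]
      · intro α hα
        have h0 := hzero _ ih β (N.tgt_mem_edges β)
        have hβ := ih β (N.tgt_mem_edges β)
        rw [N.vval_tgt, hDℓ, h0, zero_mul, add_zero] at hβ
        rw [hcont _ α hα β (N.src_mem_edges β), N.vval_src, hβ]
  refine ⟨M, fun α y hy => ?_⟩
  have hα := hall _ α (N.src_mem_edges α)
  rw [N.vval_src] at hα
  rw [hDv α y hy, hzero _ (hall _) α (N.src_mem_edges α), zero_mul, add_zero, hα]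
end

section
/- Let b ∈ PC(Γ) be such that b_α ∈ C¹([0, ℓ_α]) for every α ∈ 𝒜, and let m be a solution of the stationary Fokker–Planck problem on Γ associated with b. Then m_α ∈ C²([0, ℓ_α]) for every α ∈ 𝒜, and there is a constant C, depending only on sup_{α∈𝒜} sup_{[0,ℓ_α]} |b_α|, the numbers sup_{[0,ℓ_α]} |b_α'| (α ∈ 𝒜), the constants μ_α, the weights γ_iα and the network Γ, such that sup_{[0,ℓ_α]} |m_α| + sup_{[0,ℓ_α]} |m_α'| + sup_{[0,ℓ_α]} |m_α''| ≤ C for every α ∈ 𝒜. -/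
open Set

/-- A nonnegative function of mass at most `1` is at most `1 / (v - u)` somewhere on `[u, v]`. -/
theorem exists_le_inv_length_of_integral_le_one {f : ℝ → ℝ} {ℓ u v : ℝ}
    (hf : ContinuousOn f (Icc 0 ℓ)) (hf0 : ∀ y ∈ Icc (0:ℝ) ℓ, 0 ≤ f y)
    (hint : ∫ y in (0:ℝ)..ℓ, f y ≤ 1) (hu : 0 ≤ u) (huv : u < v) (hv : v ≤ ℓ) :
    ∃ t ∈ Icc u v, f t ≤ 1 / (v - u) := by
  by_contra! h
  have hsub : Icc u v ⊆ Icc 0 ℓ := Icc_subset_Icc hu hv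
  have hfuv : ContinuousOn f (Icc u v) := hf.mono hsub
  have hle : ∫ y in u..v, f y ≤ ∫ y in (0:ℝ)..ℓ, f y := by
    refine intervalIntegral.integral_mono_interval hu huv.le hv ?_
      (hf.intervalIntegrable_of_Icc (hu.trans (huv.le.trans hv)))
    filter_upwards [MeasureTheory.ae_restrict_mem measurableSet_Ioc] with y hy
    exact hf0 y (Ioc_subset_Icc_self hy)
  have hlt : ∫ _y in u..v, 1 / (v - u) < ∫ y in u..v, f y :=
    intervalIntegral.integral_lt_integral_of_continuousOn_of_le_of_exists_lt huv
      continuousOn_const hfuv (fun y hy => (h y (Ioc_subset_Icc_self hy)).le)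
      ⟨u, left_mem_Icc.2 huv.le, h u (left_mem_Icc.2 huv.le)⟩
  have hone : ∫ _y in u..v, 1 / (v - u) = 1 := by
    rw [intervalIntegral.integral_const, smul_eq_mul, mul_one_div_cancel (sub_pos.2 huv).ne']
  linarith

/-- Integrating the first integral `μ m' + b m = c`: the increment of `μ m` differs from that of
`c y` by at most `B` when `|b| ≤ B` and `m` is nonnegative of mass at most `1`. -/
theorem abs_first_integral_increment_le {ℓ μ B c : ℝ} {b m m' : ℝ → ℝ}
    (hb : ContinuousOn b (Icc 0 ℓ)) (hbB : ∀ y ∈ Icc (0:ℝ) ℓ, |b y| ≤ B)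
    (hm : ∀ y ∈ Icc (0:ℝ) ℓ, HasDerivWithinAt m (m' y) (Icc 0 ℓ) y)
    (hc : ∀ y ∈ Icc (0:ℝ) ℓ, μ * m' y + b y * m y = c)
    (hm0 : ∀ y ∈ Icc (0:ℝ) ℓ, 0 ≤ m y) (hint : ∫ y in (0:ℝ)..ℓ, m y ≤ 1)
    {s t : ℝ} (hs : 0 ≤ s) (hst : s ≤ t) (ht : t ≤ ℓ) :
    |c * (t - s) - μ * (m t - m s)| ≤ B := by
  have hsub : Icc s t ⊆ Icc 0 ℓ := Icc_subset_Icc hs ht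
  have hmc : ContinuousOn m (Icc 0 ℓ) := fun y hy => (hm y hy).continuousWithinAt
  have hB : 0 ≤ B := (abs_nonneg _).trans (hbB s ⟨hs, hst.trans ht⟩)
  have hbm : ContinuousOn (fun y => b y * m y) (Icc s t) := (hb.mul hmc).mono hsub
  have hftc : ∫ y in s..t, b y * m y = (c * t - μ * m t) - (c * s - μ * m s) := by
    refine intervalIntegral.integral_eq_sub_of_hasDerivAt_of_le
      (f := fun y => c * y - μ * m y) hst ?_ (fun y hy => ?_)
      (hbm.intervalIntegrable_of_Icc hst)
    · exact (continuousOn_const.mul continuousOn_id).sub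
        (continuousOn_const.mul (hmc.mono hsub))
    · have hy' : y ∈ Icc 0 ℓ := hsub (Ioo_subset_Icc_self hy)
      have hd : HasDerivAt m (m' y) y :=
        (hm y hy').hasDerivAt (Icc_mem_nhds (hs.trans_lt hy.1) (hy.2.trans_le ht))
      have h := ((hasDerivAt_id y).const_mul c).sub (hd.const_mul μ)
      rw [show b y * m y = c * 1 - μ * m' y by linarith [hc y hy']]
      exact h
  have hmass : ∫ y in s..t, m y ≤ 1 := by
    refine le_trans (intervalIntegral.integral_mono_interval hs hst ht ?_
      (hmc.intervalIntegrable_of_Icc (hs.trans (hst.trans ht)))) hint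
    filter_upwards [MeasureTheory.ae_restrict_mem measurableSet_Ioc] with y hy
    exact hm0 y (Ioc_subset_Icc_self hy)
  have hbound : |∫ y in s..t, b y * m y| ≤ ∫ y in s..t, B * m y := by
    refine intervalIntegral.norm_integral_le_of_norm_le (f := fun y => b y * m y)
      (g := fun y => B * m y) hst ?_
      ((continuousOn_const.mul (hmc.mono hsub)).intervalIntegrable_of_Icc hst)
    refine MeasureTheory.ae_of_all _ fun y hy => ?_
    have hy' := hsub (Ioc_subset_Icc_self hy)
    rw [Real.norm_eq_abs, abs_mul, abs_of_nonneg (hm0 y hy')]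
    exact mul_le_mul_of_nonneg_right (hbB y hy') (hm0 y hy')
  rw [intervalIntegral.integral_const_mul] at hbound
  calc |c * (t - s) - μ * (m t - m s)| = |∫ y in s..t, b y * m y| := by rw [hftc]; ring_nf
    _ ≤ B * ∫ y in s..t, m y := hbound
    _ ≤ B := mul_le_of_le_one_right hB hmass

/-- `C²` estimate for the Fokker–Planck equation on a single edge: no condition at the
endpoints is needed. -/
theorem exists_C2_bound_on_edge {ℓ μ : ℝ} (hℓ : 0 < ℓ) (hμ : 0 < μ) (B : ℝ) :
    ∃ C : ℝ, ∀ b b' m m' : ℝ → ℝ, ∀ c : ℝ,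
      (∀ y ∈ Icc (0:ℝ) ℓ, HasDerivWithinAt b (b' y) (Icc 0 ℓ) y) →
      ContinuousOn b' (Icc 0 ℓ) →
      (∀ y ∈ Icc (0:ℝ) ℓ, |b y| ≤ B) → (∀ y ∈ Icc (0:ℝ) ℓ, |b' y| ≤ B) →
      (∀ y ∈ Icc (0:ℝ) ℓ, HasDerivWithinAt m (m' y) (Icc 0 ℓ) y) →
      (∀ y ∈ Icc (0:ℝ) ℓ, μ * m' y + b y * m y = c) →
      (∀ y ∈ Icc (0:ℝ) ℓ, 0 ≤ m y) → ∫ y in (0:ℝ)..ℓ, m y ≤ 1 →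
      ∃ m'' : ℝ → ℝ,
        (∀ y ∈ Icc (0:ℝ) ℓ, HasDerivWithinAt m' (m'' y) (Icc 0 ℓ) y) ∧
        ContinuousOn m'' (Icc 0 ℓ) ∧
        ∀ y ∈ Icc (0:ℝ) ℓ, ∀ z ∈ Icc (0:ℝ) ℓ, ∀ w ∈ Icc (0:ℝ) ℓ,
          |m y| + |m' z| + |m'' w| ≤ C := by
  let K := (μ * (2 / ℓ) + B) * (2 / ℓ)
  let M₀ := 1 / ℓ + (K * ℓ + B) / μ
  let M₁ := (K + B * M₀) / μ
  let M₂ := (B * M₀ + B * M₁) / μ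
  refine ⟨M₀ + M₁ + M₂, fun b b' m m' c hb hb'c hbB hb'B hm hc hm0 hint => ?_⟩
  have hB : 0 ≤ B := (abs_nonneg _).trans (hbB 0 ⟨le_rfl, hℓ.le⟩)
  have hbc : ContinuousOn b (Icc 0 ℓ) := fun y hy => (hb y hy).continuousWithinAt
  have hmc : ContinuousOn m (Icc 0 ℓ) := fun y hy => (hm y hy).continuousWithinAt
  have hincr : ∀ s t : ℝ, 0 ≤ s → s ≤ t → t ≤ ℓ → |c * (t - s) - μ * (m t - m s)| ≤ B :=
    fun s t => abs_first_integral_increment_le hbc hbB hm hc hm0 hint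
  have hcK : |c| ≤ K := by
    have hinv : 1 / (ℓ / 2) = 2 / ℓ := by field_simp
    have hR : 0 ≤ μ * (2 / ℓ) + B := by positivity
    have key : ∀ a d : ℝ, ℓ / 2 ≤ d → a * d ≤ μ * (2 / ℓ) + B → a ≤ K := by
      intro a d hd had
      rcases le_total a 0 with ha | ha
      · exact ha.trans (by positivity)
      · have h1 : a * (ℓ / 2) ≤ μ * (2 / ℓ) + B :=
          (mul_le_mul_of_nonneg_left hd ha).trans had
        calc a = a * (ℓ / 2) * (2 / ℓ) := by field_simp
          _ ≤ K := mul_le_mul_of_nonneg_right h1 (by positivity)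
    refine abs_le'.2 ⟨?_, ?_⟩
    · obtain ⟨t, ht, hmt⟩ := exists_le_inv_length_of_integral_le_one hmc hm0 hint
        (by positivity : 0 ≤ ℓ / 2) (by linarith : ℓ / 2 < ℓ) le_rfl
      rw [show ℓ - ℓ / 2 = ℓ / 2 by ring, hinv] at hmt
      have h := (abs_le.1 (hincr 0 t le_rfl (by linarith [ht.1]) ht.2)).2
      refine key c t ht.1 ?_
      nlinarith [mul_le_mul_of_nonneg_left hmt hμ.le,
        mul_nonneg hμ.le (hm0 0 ⟨le_rfl, hℓ.le⟩)]
    · obtain ⟨s, hs, hms⟩ := exists_le_inv_length_of_integral_le_one hmc hm0 hint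
        le_rfl (by linarith : 0 < ℓ / 2) (by linarith)
      rw [sub_zero, hinv] at hms
      have h := (abs_le.1 (hincr s ℓ hs.1 (by linarith [hs.2]) le_rfl)).1
      refine key (-c) (ℓ - s) (by linarith [hs.2]) ?_
      nlinarith [mul_le_mul_of_nonneg_left hms hμ.le,
        mul_nonneg hμ.le (hm0 ℓ ⟨hℓ.le, le_rfl⟩)]
  have hM₀ : ∀ y ∈ Icc (0:ℝ) ℓ, |m y| ≤ M₀ := by
    intro y hy
    obtain ⟨s, hs, hms⟩ := exists_le_inv_length_of_integral_le_one hmc hm0 hint le_rfl hℓ le_rfl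
    rw [sub_zero] at hms
    have hcd : ∀ d : ℝ, |d| ≤ ℓ → |c * d| ≤ K * ℓ := fun d hd => by
      rw [abs_mul]
      exact mul_le_mul hcK hd (abs_nonneg _) ((abs_nonneg _).trans hcK)
    have hdiff : μ * (m y - m s) ≤ K * ℓ + B := by
      have hcy := (abs_le.1 (hcd (y - s) (abs_le.2
        ⟨by linarith [hs.2, hy.1], by linarith [hs.1, hy.2]⟩))).2
      rcases le_total s y with h | h
      · have := (abs_le.1 (hincr s y hs.1 h hy.2)).1
        linarith
      · have := (abs_le.1 (hincr y s hy.1 h hs.2)).2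
        linarith
    have hdiv : m y - m s ≤ (K * ℓ + B) / μ := by
      rw [le_div_iff₀ hμ]
      linarith
    rw [abs_of_nonneg (hm0 y hy)]
    show m y ≤ 1 / ℓ + (K * ℓ + B) / μ
    linarith
  have hm'eq : ∀ y ∈ Icc (0:ℝ) ℓ, m' y = (c - b y * m y) / μ := fun y hy => by
    rw [eq_div_iff hμ.ne']
    linarith [hc y hy]
  have hM₁ : ∀ y ∈ Icc (0:ℝ) ℓ, |m' y| ≤ M₁ := by
    intro y hy
    rw [hm'eq y hy, abs_div, abs_of_pos hμ]
    refine div_le_div_of_nonneg_right ((abs_sub _ _).trans (add_le_add hcK ?_)) hμ.le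
    rw [abs_mul]
    exact mul_le_mul (hbB y hy) (hM₀ y hy) (abs_nonneg _) hB
  have hm'c : ContinuousOn m' (Icc 0 ℓ) :=
    ((continuousOn_const.sub (hbc.mul hmc)).div_const μ).congr hm'eq
  refine ⟨fun y => -(b' y * m y + b y * m' y) / μ, fun y hy => ?_, ?_, ?_⟩
  · have h := (((hb y hy).mul (hm y hy)).const_sub c).div_const μ
    exact h.congr hm'eq (hm'eq y hy)
  · exact ((hb'c.mul hmc).add (hbc.mul hm'c)).neg.div_const μ
  · intro y hy z hz w hw
    refine add_le_add (add_le_add (hM₀ y hy) (hM₁ z hz)) ?_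
    rw [abs_div, abs_neg, abs_of_pos hμ]
    refine div_le_div_of_nonneg_right ((abs_add_le _ _).trans (add_le_add ?_ ?_)) hμ.le
    · rw [abs_mul]
      exact mul_le_mul (hb'B w hw) (hM₀ w hw) (abs_nonneg _) hB
    · rw [abs_mul]
      exact mul_le_mul (hbB w hw) (hM₁ w hw) (abs_nonneg _) hB

/-- if the drift `b` is `C¹` on each edge (with derivative `b'`, both bounded
by `B`), then any solution of the stationary Fokker–Planck problem is `C²` on each edge and
its `C²` norm is bounded by a constant depending only on `B`, `μ`, `γ` and the network. -/
theorem stmt_7 {I A : Type} [Fintype I] [Fintype A] [DecidableEq I]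
    (N : Network I A) (μ : A → ℝ) (γ : I → A → ℝ)
    (hμ : ∀ α, 0 < μ α) (hγ : ∀ i : I, ∀ α ∈ N.edges i, 0 < γ i α)
    (B : ℝ) :
    ∃ C : ℝ, ∀ b b' : A → ℝ → ℝ,
      (∀ α, ∀ y ∈ Icc (0:ℝ) (N.ℓ α), HasDerivWithinAt (b α) (b' α y) (Icc 0 (N.ℓ α)) y) →
      (∀ α, ContinuousOn (b' α) (Icc (0:ℝ) (N.ℓ α))) →
      (∀ α, ∀ y ∈ Icc (0:ℝ) (N.ℓ α), |b α y| ≤ B) →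
      (∀ α, ∀ y ∈ Icc (0:ℝ) (N.ℓ α), |b' α y| ≤ B) →
      ∀ m m' : A → ℝ → ℝ, Network.IsFPSolution N μ γ b m m' →
        ∃ m'' : A → ℝ → ℝ,
          (∀ α, ∀ y ∈ Icc (0:ℝ) (N.ℓ α),
            HasDerivWithinAt (m' α) (m'' α y) (Icc 0 (N.ℓ α)) y) ∧
          (∀ α, ContinuousOn (m'' α) (Icc (0:ℝ) (N.ℓ α))) ∧
          (∀ α, ∀ y ∈ Icc (0:ℝ) (N.ℓ α), ∀ z ∈ Icc (0:ℝ) (N.ℓ α),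
            ∀ w ∈ Icc (0:ℝ) (N.ℓ α), |m α y| + |m' α z| + |m'' α w| ≤ C) := by
  choose C hC using fun α => exists_C2_bound_on_edge (N.ℓ_pos α) (hμ α) B
  obtain ⟨D, hD⟩ := (Set.finite_range C).bddAbove
  refine ⟨D, fun b b' hb hb'c hbB hb'B m m' hsol => ?_⟩
  obtain ⟨hm, -, -, hc, -, hm0, hint⟩ := hsol
  have hmass : ∀ α, ∫ y in (0:ℝ)..(N.ℓ α), m α y ≤ 1 := fun α => by
    rw [← hint]
    exact Finset.single_le_sum (f := fun α => ∫ y in (0:ℝ)..(N.ℓ α), m α y)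
      (fun β _ => intervalIntegral.integral_nonneg (N.ℓ_pos β).le (hm0 β)) (Finset.mem_univ α)
  choose c hc using hc
  choose m'' h1 h2 h3 using fun α => hC α (b α) (b' α) (m α) (m' α) (c α) (hb α) (hb'c α)
    (hbB α) (hb'B α) (hm α) (hc α) (hm0 α) (hmass α)
  exact ⟨m'', h1, h2, fun α y hy z hz w hw =>
    (h3 α y hy z hz w hw).trans (hD (Set.mem_range_self α))⟩
end

section
/- Let λ > 0 and, for each α ∈ 𝒜, let H_α : [0, ℓ_α] × ℝ → ℝ be continuous with |H_α(x, p)| ≤ C_H for all (x, p), for some constant C_H > 0. Then there exists v ∈ C²(Γ) such that −μ_α v_α''(y) + H_α(y, v_α'(y)) + λ v_α(y) = 0 for all y ∈ (0, ℓ_α) and all α ∈ 𝒜, and the Kirchhoff conditions ∑_{α∈𝒜_i} γ_iα μ_α ∂_α v(ν_i) = 0 hold at every vertex ν_i, i ∈ I. Moreover, if each H_α is locally Lipschitz on [0, ℓ_α] × ℝ, then v can be taken so that in addition v_α'' is Lipschitz continuous on [0, ℓ_α] for every α ∈ 𝒜. -/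
open Set

/-- A `C²` function on the network satisfying the Kirchhoff conditions, bundled with its first
and second edgewise derivatives. -/
structure KirchhoffFunction {I A : Type} [Fintype I] [Fintype A] [DecidableEq I]
    (N : Network I A) (μ : A → ℝ) (γ : I → A → ℝ) where
  val : A → ℝ → ℝ
  der : A → ℝ → ℝ
  der2 : A → ℝ → ℝ
  isC2 : N.IsC2 val der der2
  kirchhoff : N.Kirchhoff μ γ der

/-- Families of continuous functions on the edges of a network, with the supremum norm. -/
abbrev Network.EdgeMap {I A : Type} [Fintype I] [Fintype A] [DecidableEq I]
    (N : Network I A) : Type :=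
  (α : A) → C(Icc (0 : ℝ) (N.ℓ α), ℝ)

theorem exists_pos_forall_le {A : Type} [Finite A] (f : A → ℝ) (hf : ∀ α, 0 < f α) :
    ∃ m > 0, ∀ α, m ≤ f α := by
  cases isEmpty_or_nonempty A with
  | inl h => exact ⟨1, one_pos, fun α => h.elim α⟩
  | inr h =>
    obtain ⟨a, ha⟩ := Finite.exists_min f
    exact ⟨f a, hf a, ha⟩

theorem exists_fixedPoint_of_dist_le {E : Type*} [MetricSpace E] [CompleteSpace E] [Nonempty E]
    (T : E → E) {K : ℝ} (hK0 : 0 ≤ K) (hK1 : K < 1)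
    (hT : ∀ x y, dist (T x) (T y) ≤ K * dist x y) : ∃ x, T x = x := by
  have hc : ContractingWith ⟨K, hK0⟩ T :=
    ⟨by exact_mod_cast hK1, LipschitzWith.of_dist_le_mul hT⟩
  exact ⟨_, hc.fixedPoint_isFixedPt⟩

section Interval

variable {v v' v'' : ℝ → ℝ} {l : ℝ}

/-- The mean value theorem on a subinterval of `[0, l]`, for derivatives within `[0, l]`. -/
theorem exists_hasDerivWithinAt_eq_slope
    (hv : ∀ y ∈ Icc (0 : ℝ) l, HasDerivWithinAt v (v' y) (Icc 0 l) y)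
    {a b : ℝ} (ha : 0 ≤ a) (hab : a < b) (hb : b ≤ l) :
    ∃ ξ ∈ Ioo a b, v b - v a = v' ξ * (b - a) := by
  obtain ⟨ξ, hξ, h⟩ := exists_hasDerivAt_eq_slope v v' hab
    (fun y hy => ((hv y ⟨ha.trans hy.1, hy.2.trans hb⟩).continuousWithinAt).mono
      (Icc_subset_Icc ha hb))
    (fun y hy => (hv y ⟨(ha.trans_lt hy.1).le, (hy.2.trans_le hb).le⟩).hasDerivAt
      (Icc_mem_nhds (ha.trans_lt hy.1) (hy.2.trans_le hb)))
  refine ⟨ξ, hξ, ?_⟩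
  rw [h, div_mul_cancel₀ _ (sub_pos.2 hab).ne']

/-- Interpolation: the first derivative is controlled by the function and its second
derivative. -/
theorem abs_deriv_le_of_abs_le
    (hv : ∀ y ∈ Icc (0 : ℝ) l, HasDerivWithinAt v (v' y) (Icc 0 l) y)
    (hv' : ∀ y ∈ Icc (0 : ℝ) l, HasDerivWithinAt v' (v'' y) (Icc 0 l) y)
    {a b h : ℝ} (ha : ∀ y ∈ Icc (0 : ℝ) l, |v y| ≤ a) (hb : ∀ y ∈ Icc (0 : ℝ) l, |v'' y| ≤ b)
    (hh : 0 < h) (hhl : h ≤ l) {y : ℝ} (hy : y ∈ Icc (0 : ℝ) l) :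
    |v' y| ≤ 2 * a / h + b * h := by
  obtain ⟨c, hc0, hcl, hcy, hyc⟩ : ∃ c, 0 ≤ c ∧ c + h ≤ l ∧ c ≤ y ∧ y ≤ c + h := by
    rcases le_total y (l - h) with h1 | h1
    · exact ⟨y, hy.1, by linarith, le_rfl, by linarith⟩
    · exact ⟨l - h, by linarith, by linarith, h1, by linarith [hy.2]⟩
  obtain ⟨ξ, hξ, hs⟩ := exists_hasDerivWithinAt_eq_slope hv hc0 (lt_add_of_pos_right c hh) hcl
  have hξl : ξ ∈ Icc (0 : ℝ) l := ⟨by linarith [hξ.1], by linarith [hξ.2]⟩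
  have h1 : |v' ξ| ≤ 2 * a / h := by
    rw [le_div_iff₀ hh, ← abs_of_pos hh, ← abs_mul]
    have h2 := ha (c + h) ⟨by linarith, hcl⟩
    have h3 := ha c ⟨hc0, by linarith⟩
    have h4 : v' ξ * h = v (c + h) - v c := by rw [hs]; ring
    rw [h4]
    have := abs_sub (v (c + h)) (v c)
    linarith
  have h2 : |v' y - v' ξ| ≤ b * |y - ξ| := by
    simpa using (convex_Icc (0 : ℝ) l).norm_image_sub_le_of_norm_hasDerivWithin_le hv'
      (fun x hx => hb x hx) hξl hy
  have h3 : |y - ξ| ≤ h := abs_le.2 ⟨by linarith [hξ.2], by linarith [hξ.1]⟩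
  have hb0 : 0 ≤ b := (abs_nonneg _).trans (hb y hy)
  have h4 : |v' y| ≤ |v' ξ| + |v' y - v' ξ| := by
    have := abs_add_le (v' ξ) (v' y - v' ξ)
    simpa using this
  nlinarith [mul_le_mul_of_nonneg_left h3 hb0]

theorem deriv_nonpos_of_max_left (hl : 0 < l)
    (hv : ∀ y ∈ Icc (0 : ℝ) l, HasDerivWithinAt v (v' y) (Icc 0 l) y)
    (hmax : ∀ y ∈ Icc (0 : ℝ) l, v y ≤ v 0) : v' 0 ≤ 0 := by
  by_contra! hpos
  have h0 := hv 0 ⟨le_rfl, hl.le⟩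
  have h1 := (hasDerivWithinAt_iff_tendsto_slope.1 h0).eventually (lt_mem_nhds hpos)
  have h2 : Icc (0 : ℝ) l \ {0} = Ioc 0 l := Icc_sdiff_left
  rw [h2, nhdsWithin_Ioc_eq_nhdsGT hl] at h1
  obtain ⟨y, hy1, hy2⟩ := (h1.and (Ioc_mem_nhdsGT hl)).exists
  rw [slope_def_field, sub_zero] at hy1
  have h3 := hmax y ⟨hy2.1.le, hy2.2⟩
  have h4 : (v y - v 0) / y ≤ 0 := div_nonpos_of_nonpos_of_nonneg (by linarith) hy2.1.le
  linarith

theorem deriv_nonneg_of_max_right (hl : 0 < l)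
    (hv : ∀ y ∈ Icc (0 : ℝ) l, HasDerivWithinAt v (v' y) (Icc 0 l) y)
    (hmax : ∀ y ∈ Icc (0 : ℝ) l, v y ≤ v l) : 0 ≤ v' l := by
  by_contra! hneg
  have h0 := hv l ⟨hl.le, le_rfl⟩
  have h1 := (hasDerivWithinAt_iff_tendsto_slope.1 h0).eventually (gt_mem_nhds hneg)
  have h2 : Icc (0 : ℝ) l \ {l} = Ico 0 l := Icc_sdiff_right
  rw [h2, nhdsWithin_Ico_eq_nhdsLT hl] at h1
  obtain ⟨y, hy1, hy2⟩ := (h1.and (Ico_mem_nhdsLT hl)).exists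
  rw [slope_def_field] at hy1
  have h3 := hmax y ⟨hy2.1, hy2.2.le⟩
  have h4 : 0 ≤ (v y - v l) / (y - l) :=
    div_nonneg_of_nonpos (by linarith) (by linarith [hy2.2])
  linarith

/-- The second order necessary condition at a critical maximum point, possibly an endpoint. -/
theorem deriv2_nonpos_of_max (hl : 0 < l)
    (hv : ∀ y ∈ Icc (0 : ℝ) l, HasDerivWithinAt v (v' y) (Icc 0 l) y)
    (hv' : ∀ y ∈ Icc (0 : ℝ) l, HasDerivWithinAt v' (v'' y) (Icc 0 l) y)
    {z : ℝ} (hz : z ∈ Icc (0 : ℝ) l) (hmax : ∀ y ∈ Icc (0 : ℝ) l, v y ≤ v z)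
    (hcrit : v' z = 0) : v'' z ≤ 0 := by
  by_contra! hpos
  have h1 := (hasDerivWithinAt_iff_tendsto_slope.1 (hv' z hz)).eventually (lt_mem_nhds hpos)
  rw [eventually_nhdsWithin_iff, Metric.eventually_nhds_iff] at h1
  obtain ⟨ε, hε, h1⟩ := h1
  have key : ∀ y ∈ Icc (0 : ℝ) l, |y - z| < ε → y ≠ z → 0 < v' y / (y - z) := by
    intro y hy hyz hne
    have := h1 (y := y) (by rwa [Real.dist_eq]) ⟨hy, hne⟩
    rwa [slope_def_field, hcrit, sub_zero] at this
  rcases hz.2.lt_or_eq with hlt | heq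
  · set y := min l (z + ε / 2) with hy
    have hzy : z < y := lt_min hlt (by linarith)
    have hyl : y ≤ l := min_le_left _ _
    have hyε : y ≤ z + ε / 2 := min_le_right _ _
    obtain ⟨ξ, hξ, hs⟩ := exists_hasDerivWithinAt_eq_slope hv hz.1 hzy hyl
    have h2 := key ξ ⟨by linarith [hz.1, hξ.1], by linarith [hξ.2]⟩
      (by rw [abs_of_pos (by linarith [hξ.1])]; linarith [hξ.2]) hξ.1.ne'
    have h3 : 0 < v' ξ := (div_pos_iff_of_pos_right (by linarith [hξ.1])).1 h2
    have h4 := hmax y ⟨by linarith [hz.1], hyl⟩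
    nlinarith [mul_pos h3 (sub_pos.2 hzy)]
  · set y := max 0 (z - ε / 2) with hy
    have hzy : y < z := max_lt (by linarith) (by linarith)
    have hyl : 0 ≤ y := le_max_left _ _
    have hyε : z - ε / 2 ≤ y := le_max_right _ _
    obtain ⟨ξ, hξ, hs⟩ := exists_hasDerivWithinAt_eq_slope hv hyl hzy hz.2
    have h2 := key ξ ⟨by linarith [hξ.1], by linarith [hξ.2, hz.2]⟩
      (by rw [abs_of_neg (by linarith [hξ.2])]; linarith [hξ.1]) hξ.2.ne
    have h3 : v' ξ < 0 := by
      rcases div_pos_iff.1 h2 with h | h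
      · linarith [hξ.2, h.2]
      · exact h.1
    have h4 := hmax y ⟨hyl, by linarith [hz.2]⟩
    nlinarith [mul_pos (neg_pos.2 h3) (sub_pos.2 hzy)]

end Interval

namespace KirchhoffFunction

variable {I A : Type} [Fintype I] [Fintype A] [DecidableEq I]
  {N : Network I A} {μ : A → ℝ} {γ : I → A → ℝ}

/-- The difference of two functions satisfying the Kirchhoff conditions. -/
def sub (u w : KirchhoffFunction N μ γ) : KirchhoffFunction N μ γ where
  val α y := u.val α y - w.val α y
  der α y := u.der α y - w.der α y
  der2 α y := u.der2 α y - w.der2 α y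
  isC2 := by
    refine ⟨fun α y hy => (u.isC2.1 α y hy).sub (w.isC2.1 α y hy),
      fun α y hy => (u.isC2.2.1 α y hy).sub (w.isC2.2.1 α y hy),
      fun α => (u.isC2.2.2.1 α).sub (w.isC2.2.2.1 α), fun i α hα β hβ => ?_⟩
    have h1 := u.isC2.2.2.2 i α hα β hβ
    have h2 := w.isC2.2.2.2 i α hα β hβ
    simp only [Network.vval] at h1 h2 ⊢
    split_ifs at h1 h2 ⊢ <;> linarith
  kirchhoff := by
    intro i
    have h1 := u.kirchhoff i
    have h2 := w.kirchhoff i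
    rw [← sub_eq_zero.2 (h1.trans h2.symm), ← Finset.sum_sub_distrib]
    refine Finset.sum_congr rfl fun α _ => ?_
    simp only [Network.oderiv]
    split_ifs <;> ring

/-- The restriction of the values to the edges. -/
def valMap (u : KirchhoffFunction N μ γ) : N.EdgeMap := fun α =>
  ⟨fun y => u.val α y, continuousOn_iff_continuous_domRestrict.1
    fun y hy => (u.isC2.1 α y hy).continuousWithinAt⟩

/-- The restriction of the derivatives to the edges. -/
def derMap (u : KirchhoffFunction N μ γ) : N.EdgeMap := fun α =>
  ⟨fun y => u.der α y, continuousOn_iff_continuous_domRestrict.1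
    fun y hy => (u.isC2.2.1 α y hy).continuousWithinAt⟩

/-- The zero function, seen as a function satisfying the Kirchhoff conditions. -/
def zero : KirchhoffFunction N μ γ where
  val _ _ := 0
  der _ _ := 0
  der2 _ _ := 0
  isC2 := ⟨fun _ _ _ => hasDerivWithinAt_const .., fun _ _ _ => hasDerivWithinAt_const ..,
    fun _ => continuousOn_const, fun _ _ _ _ _ => by simp [Network.vval]⟩
  kirchhoff _ := by simp [Network.oderiv]

/-- The derivative of a function satisfying the Kirchhoff conditions vanishes at every maximum
point. -/
theorem der_eq_zero_of_max (u : KirchhoffFunction N μ γ) (hμ : ∀ α, 0 < μ α)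
    (hγ : ∀ i : I, ∀ α ∈ N.edges i, 0 < γ i α) {α : A} {z : ℝ} (hz : z ∈ Icc (0 : ℝ) (N.ℓ α))
    (hmax : ∀ β, ∀ y ∈ Icc (0 : ℝ) (N.ℓ β), u.val β y ≤ u.val α z) : u.der α z = 0 := by
  obtain ⟨hd, -, -, hc⟩ := u.isC2
  have vertex : ∀ i, α ∈ N.edges i → N.vval u.val i α = u.val α z →
      N.oderiv u.der i α = 0 := by
    intro i hi hval
    have hnn : ∀ β ∈ N.edges i, 0 ≤ γ i β * μ β * N.oderiv u.der i β := by
      intro β hβ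
      refine mul_nonneg (mul_pos (hγ i β hβ) (hμ β)).le ?_
      have hvβ : N.vval u.val i β = u.val α z := (hc i β hβ α hi).trans hval
      unfold Network.vval at hvβ
      unfold Network.oderiv
      split_ifs at hvβ ⊢ with hs
      · exact neg_nonneg.2 (deriv_nonpos_of_max_left (N.ℓ_pos β) (hd β)
          fun y hy => (hmax β y hy).trans_eq hvβ.symm)
      · exact deriv_nonneg_of_max_right (N.ℓ_pos β) (hd β)
          fun y hy => (hmax β y hy).trans_eq hvβ.symm
    have h0 := (Finset.sum_eq_zero_iff_of_nonneg hnn).1 (u.kirchhoff i) α hi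
    exact (mul_eq_zero.1 h0).resolve_left (mul_pos (hγ i α hi) (hμ α)).ne'
  rcases hz.1.eq_or_lt with h0 | h0
  · subst h0
    have := vertex (N.src α) (by simp [Network.edges]) (by simp [Network.vval])
    simpa [Network.oderiv] using this
  rcases hz.2.eq_or_lt with h1 | h1
  · subst h1
    have := vertex (N.tgt α) (by simp [Network.edges])
      (by simp [Network.vval, N.src_ne_tgt])
    simpa [Network.oderiv, N.src_ne_tgt] using this
  · have hn : Icc 0 (N.ℓ α) ∈ nhds z := Icc_mem_nhds h0 h1
    refine IsLocalMax.hasDerivAt_eq_zero ?_ ((hd α z hz).hasDerivAt hn)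
    filter_upwards [hn] with y hy using hmax α y hy

/-- The maximum principle. -/
theorem mul_val_le (u : KirchhoffFunction N μ γ) (hμ : ∀ α, 0 < μ α)
    (hγ : ∀ i : I, ∀ α ∈ N.edges i, 0 < γ i α) {Λ c : ℝ} (hΛ : 0 < Λ)
    (h : ∀ α, ∀ y ∈ Icc (0 : ℝ) (N.ℓ α), u.der α y = 0 →
      -(μ α * u.der2 α y) + Λ * u.val α y ≤ c) :
    ∀ α, ∀ y ∈ Icc (0 : ℝ) (N.ℓ α), Λ * u.val α y ≤ c := by
  intro α y hy
  have hne : Nonempty A := ⟨α⟩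
  have hmaxα : ∀ β, ∃ z ∈ Icc (0 : ℝ) (N.ℓ β), ∀ y ∈ Icc (0 : ℝ) (N.ℓ β),
      u.val β y ≤ u.val β z := fun β =>
    isCompact_Icc.exists_isMaxOn ⟨0, le_rfl, (N.ℓ_pos β).le⟩
      fun y hy => (u.isC2.1 β y hy).continuousWithinAt
  choose z hz hzmax using hmaxα
  obtain ⟨β, hβ⟩ := Finite.exists_max fun β => u.val β (z β)
  have hmax : ∀ δ, ∀ y ∈ Icc (0 : ℝ) (N.ℓ δ), u.val δ y ≤ u.val β (z β) :=
    fun δ y hy => (hzmax δ y hy).trans (hβ δ)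
  have hcrit := u.der_eq_zero_of_max hμ hγ (hz β) hmax
  have h2 := deriv2_nonpos_of_max (N.ℓ_pos β) (u.isC2.1 β) (u.isC2.2.1 β) (hz β) (hmax β) hcrit
  have h3 := h β (z β) (hz β) hcrit
  have h4 := mul_le_mul_of_nonneg_left (hmax α y hy) hΛ.le
  nlinarith [hμ β]

theorem mul_abs_val_le (u : KirchhoffFunction N μ γ) (hμ : ∀ α, 0 < μ α)
    (hγ : ∀ i : I, ∀ α ∈ N.edges i, 0 < γ i α) {Λ c : ℝ} (hΛ : 0 < Λ)
    (h : ∀ α, ∀ y ∈ Icc (0 : ℝ) (N.ℓ α), u.der α y = 0 →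
      |-(μ α * u.der2 α y) + Λ * u.val α y| ≤ c) :
    ∀ α, ∀ y ∈ Icc (0 : ℝ) (N.ℓ α), Λ * |u.val α y| ≤ c := by
  intro α y hy
  have h1 := u.mul_val_le hμ hγ hΛ (fun α y hy h0 => (abs_le.1 (h α y hy h0)).2) α y hy
  have h2 := (zero.sub u).mul_val_le hμ hγ hΛ (c := c) (fun α y hy h0 => by
    have h0' : u.der α y = 0 := by simpa [sub, zero] using h0
    have := (abs_le.1 (h α y hy h0')).1
    simp only [sub, zero]
    linarith) α y hy
  simp only [sub, zero] at h2
  rw [← abs_of_pos hΛ, ← abs_mul]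
  exact abs_le.2 ⟨by linarith, h1⟩

/-- A priori bounds for the linear equation. -/
theorem abs_der2_le (u : KirchhoffFunction N μ γ) (hμ : ∀ α, 0 < μ α)
    (hγ : ∀ i : I, ∀ α ∈ N.edges i, 0 < γ i α) {Λ c m : ℝ} (hΛ : 0 < Λ) (hm : 0 < m)
    (hmμ : ∀ α, m ≤ μ α)
    (h : ∀ α, ∀ y ∈ Icc (0 : ℝ) (N.ℓ α), |-(μ α * u.der2 α y) + Λ * u.val α y| ≤ c) :
    ∀ α, ∀ y ∈ Icc (0 : ℝ) (N.ℓ α), |u.der2 α y| ≤ 2 * c / m := by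
  intro α y hy
  have h1 := u.mul_abs_val_le hμ hγ hΛ (fun α y hy _ => h α y hy) α y hy
  have h2 := h α y hy
  rw [← abs_of_pos hΛ, ← abs_mul] at h1
  have h3 : |μ α * u.der2 α y| ≤ 2 * c := by
    rw [abs_le] at *
    constructor <;> linarith [h1.1, h1.2, h2.1, h2.2]
  rw [abs_mul, abs_of_pos (hμ α)] at h3
  rw [le_div_iff₀ hm]
  nlinarith [abs_nonneg (u.der2 α y), hmμ α]

theorem abs_der_le (u : KirchhoffFunction N μ γ) {a b h : ℝ}
    (ha : ∀ α, ∀ y ∈ Icc (0 : ℝ) (N.ℓ α), |u.val α y| ≤ a)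
    (hb : ∀ α, ∀ y ∈ Icc (0 : ℝ) (N.ℓ α), |u.der2 α y| ≤ b)
    (hh : 0 < h) (hhl : ∀ α, h ≤ N.ℓ α) :
    ∀ α, ∀ y ∈ Icc (0 : ℝ) (N.ℓ α), |u.der α y| ≤ 2 * a / h + b * h := fun α _ hy =>
  abs_deriv_le_of_abs_le (u.isC2.1 α) (u.isC2.2.1 α) (ha α) (hb α) hh (hhl α) hy

end KirchhoffFunction

/-- Solvability of the Dirichlet problem for `-μ v'' + Λ v = G` on `[0, l]`. -/
theorem exists_dirichlet_solution_s8 {μ Λ l : ℝ} (hμ : 0 < μ) (hΛ : 0 < Λ) (hl : 0 < l)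
    {G : ℝ → ℝ} (hG : Continuous G) (a b : ℝ) :
    ∃ v v' : ℝ → ℝ, (∀ y, HasDerivAt v (v' y) y) ∧
      (∀ y, HasDerivAt v' ((Λ * v y - G y) / μ) y) ∧ v 0 = a ∧ v l = b := by
  set k := √(Λ / μ) with hk
  have hk0 : 0 < k := Real.sqrt_pos.2 (div_pos hΛ hμ)
  have hk2 : k ^ 2 * μ = Λ := by rw [hk, Real.sq_sqrt (div_pos hΛ hμ).le, div_mul_cancel₀ _ hμ.ne']
  have hsinh : Real.sinh (k * l) ≠ 0 := (Real.sinh_pos_iff.2 (mul_pos hk0 hl)).ne'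
  set C : ℝ → ℝ := fun y => ∫ s in (0 : ℝ)..y, Real.cosh (k * s) * G s with hC
  set S : ℝ → ℝ := fun y => ∫ s in (0 : ℝ)..y, Real.sinh (k * s) * G s with hS
  have hdC : ∀ y, HasDerivAt C (Real.cosh (k * y) * G y) y := fun y =>
    (show Continuous fun s => Real.cosh (k * s) * G s by
      fun_prop).integral_hasStrictDerivAt 0 y |>.hasDerivAt
  have hdS : ∀ y, HasDerivAt S (Real.sinh (k * y) * G y) y := fun y =>
    (show Continuous fun s => Real.sinh (k * s) * G s by
      fun_prop).integral_hasStrictDerivAt 0 y |>.hasDerivAt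
  have hdc : ∀ y, HasDerivAt (fun y => Real.cosh (k * y)) (k * Real.sinh (k * y)) y := fun y => by
    simpa [mul_comm] using ((hasDerivAt_id y).const_mul k).cosh
  have hds : ∀ y, HasDerivAt (fun y => Real.sinh (k * y)) (k * Real.cosh (k * y)) y := fun y => by
    simpa [mul_comm] using ((hasDerivAt_id y).const_mul k).sinh
  set d := (b - (a * Real.cosh (k * l) + (Real.cosh (k * l) * S l - Real.sinh (k * l) * C l)
    / (μ * k))) / Real.sinh (k * l) with hd
  refine ⟨fun y => a * Real.cosh (k * y) + d * Real.sinh (k * y) +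
      (Real.cosh (k * y) * S y - Real.sinh (k * y) * C y) / (μ * k),
    fun y => a * (k * Real.sinh (k * y)) + d * (k * Real.cosh (k * y)) +
      (Real.sinh (k * y) * S y - Real.cosh (k * y) * C y) / μ, fun y => ?_, fun y => ?_, ?_, ?_⟩
  · refine ((((hdc y).const_mul a).add ((hds y).const_mul d)).add
      ((((hdc y).mul (hdS y)).sub ((hds y).mul (hdC y))).div_const (μ * k))).congr_deriv ?_
    field_simp
    ring
  · refine (((((hds y).const_mul k).const_mul a).add (((hdc y).const_mul k).const_mul d)).add
      ((((hds y).mul (hdS y)).sub ((hdc y).mul (hdC y))).div_const μ)).congr_deriv ?_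
    rw [← hk2]
    field_simp
    linear_combination (-G y) * Real.cosh_sq (k * y)
  · simp [hC, hS]
  · simp only [hd]
    field_simp
    ring

theorem Network.exists_mem_edges {I A : Type} [Fintype I] [Fintype A] [DecidableEq I] [Nonempty A]
    (N : Network I A) (i : I) : ∃ α, α ∈ N.edges i := by
  obtain ⟨β⟩ := ‹Nonempty A›
  rcases (N.connected i (N.src β)).cases_head with h | ⟨j, ⟨α, hα⟩, -⟩
  · exact ⟨β, by simp [Network.edges, h]⟩
  · refine ⟨α, ?_⟩
    rcases hα with h | h <;> simp [Network.edges, h.1, h.2]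

namespace KirchhoffFunction

variable {I A : Type} [Fintype I] [Fintype A] [DecidableEq I]
  {N : Network I A} {μ : A → ℝ} {γ : I → A → ℝ}

/-- The linear problem `-μ v'' + Λ v = g` with Kirchhoff conditions is solvable. -/
theorem exists_linear_solution (hμ : ∀ α, 0 < μ α)
    (hγ : ∀ i : I, ∀ α ∈ N.edges i, 0 < γ i α) {Λ : ℝ} (hΛ : 0 < Λ) (g : N.EdgeMap) :
    ∃ u : KirchhoffFunction N μ γ, ∀ α, ∀ y, ∀ hy : y ∈ Icc (0 : ℝ) (N.ℓ α),
      -(μ α * u.der2 α y) + Λ * u.val α y = g α ⟨y, hy⟩ := by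
  cases isEmpty_or_nonempty A with
  | inl h => exact ⟨zero, fun α => h.elim α⟩
  | inr hne =>
  set G : A → ℝ → ℝ := fun α => IccExtend (N.ℓ_pos α).le (g α) with hGdef
  have hG : ∀ α, Continuous (G α) := fun α => (g α).continuous.Icc_extend'
  choose p p' hp hp' hp0 hpl using fun α =>
    exists_dirichlet_solution_s8 (hμ α) hΛ (N.ℓ_pos α) (hG α) 0 0
  choose φ φ' hφ hφ' hφ0 hφl using fun α =>
    exists_dirichlet_solution_s8 (hμ α) hΛ (N.ℓ_pos α) (G := fun _ => 0) continuous_const 1 0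
  choose ψ ψ' hψ hψ' hψ0 hψl using fun α =>
    exists_dirichlet_solution_s8 (hμ α) hΛ (N.ℓ_pos α) (G := fun _ => 0) continuous_const 0 1
  have hC2 : ∀ (x : I → ℝ) (t : ℝ), N.IsC2
      (fun α y => x (N.src α) * φ α y + x (N.tgt α) * ψ α y + t * p α y)
      (fun α y => x (N.src α) * φ' α y + x (N.tgt α) * ψ' α y + t * p' α y)
      (fun α y => (Λ * (x (N.src α) * φ α y + x (N.tgt α) * ψ α y + t * p α y)
        - t * G α y) / μ α) := by
    intro x t
    have h1 : ∀ α y, HasDerivAt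
        (fun y => x (N.src α) * φ α y + x (N.tgt α) * ψ α y + t * p α y)
        (x (N.src α) * φ' α y + x (N.tgt α) * ψ' α y + t * p' α y) y := fun α y =>
      (((hφ α y).const_mul _).add ((hψ α y).const_mul _)).add ((hp α y).const_mul _)
    refine ⟨fun α y _ => (h1 α y).hasDerivWithinAt, fun α y _ => ?_, fun α => ?_, ?_⟩
    · refine (((((hφ' α y).const_mul _).add ((hψ' α y).const_mul _)).add
        ((hp' α y).const_mul _)).congr_deriv ?_).hasDerivWithinAt
      ring
    · have h2 : Continuous fun y => x (N.src α) * φ α y + x (N.tgt α) * ψ α y + t * p α y :=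
        continuous_iff_continuousAt.2 fun y => (h1 α y).continuousAt
      exact (((h2.const_mul Λ).sub ((hG α).const_mul t)).div_const _).continuousOn
    · have h3 : ∀ i, ∀ α ∈ N.edges i, N.vval
          (fun α y => x (N.src α) * φ α y + x (N.tgt α) * ψ α y + t * p α y) i α = x i := by
        intro i α hα
        simp only [Network.edges, Finset.mem_filter, Finset.mem_univ, true_and] at hα
        unfold Network.vval
        split_ifs with hs
        · simp [hφ0, hψ0, hp0, hs]
        · simp [hφl, hψl, hpl, hα.resolve_left hs]
      exact fun i α hα β hβ => (h3 i α hα).trans (h3 i β hβ).symm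
  let M : (I → ℝ) →ₗ[ℝ] (I → ℝ) :=
    { toFun := fun x i => ∑ α ∈ N.edges i, γ i α * μ α *
        N.oderiv (fun α y => x (N.src α) * φ' α y + x (N.tgt α) * ψ' α y) i α
      map_add' := fun x z => by
        ext i
        simp only [Pi.add_apply, ← Finset.sum_add_distrib, Network.oderiv]
        refine Finset.sum_congr rfl fun α _ => ?_
        split_ifs <;> ring
      map_smul' := fun c x => by
        ext i
        simp only [Pi.smul_apply, smul_eq_mul, RingHom.id_apply, Finset.mul_sum, Network.oderiv]
        refine Finset.sum_congr rfl fun α _ => ?_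
        split_ifs <;> ring }
  have hM : ∀ x i, M x i = ∑ α ∈ N.edges i, γ i α * μ α *
        N.oderiv (fun α y => x (N.src α) * φ' α y + x (N.tgt α) * ψ' α y) i α := fun _ _ => rfl
  have hinj : Function.Injective M := by
    refine (injective_iff_map_eq_zero M).2 fun x hx => ?_
    let u : KirchhoffFunction N μ γ := ⟨_, _, _, hC2 x 0, fun i => by
      have := congrFun hx i
      rw [hM] at this
      simpa using this⟩
    have hu := u.mul_abs_val_le hμ hγ hΛ (c := 0) (fun α y _ _ => by
      have := (hμ α).ne'
      simp only [u]
      rw [mul_div_cancel₀ _ this]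
      simp)
    ext i
    obtain ⟨α, hα⟩ := N.exists_mem_edges i
    simp only [Network.edges, Finset.mem_filter, Finset.mem_univ, true_and] at hα
    have hz : ∀ y ∈ Icc (0 : ℝ) (N.ℓ α), u.val α y = 0 := fun y hy =>
      abs_nonpos_iff.1 (nonpos_of_mul_nonpos_right (hu α y hy) hΛ)
    rcases hα with h | h
    · simpa [u, hφ0, hψ0, h] using hz 0 ⟨le_rfl, (N.ℓ_pos α).le⟩
    · simpa [u, hφl, hψl, h] using hz (N.ℓ α) ⟨(N.ℓ_pos α).le, le_rfl⟩
  obtain ⟨x, hx⟩ := LinearMap.injective_iff_surjective.1 hinj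
    fun i => -∑ α ∈ N.edges i, γ i α * μ α * N.oderiv p' i α
  refine ⟨⟨_, _, _, hC2 x 1, fun i => ?_⟩, fun α y hy => ?_⟩
  · have h1 := congrFun hx i
    rw [hM, eq_neg_iff_add_eq_zero, ← Finset.sum_add_distrib] at h1
    rw [← h1]
    refine Finset.sum_congr rfl fun α _ => ?_
    simp only [Network.oderiv]
    split_ifs <;> ring
  · have := (hμ α).ne'
    rw [mul_div_cancel₀ _ this]
    simp only [hGdef, IccExtend_of_mem _ _ hy]
    ring

/-- Solvability for a Hamiltonian that is Lipschitz in the gradient variable and a large zeroth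
order coefficient. -/
theorem exists_solution_of_lipschitz_large (hμ : ∀ α, 0 < μ α)
    (hγ : ∀ i : I, ∀ α ∈ N.edges i, 0 < γ i α) {H : A → ℝ → ℝ → ℝ}
    (hH : ∀ α, Continuous fun z : ℝ × ℝ => H α z.1 z.2) {L : ℝ} (hL : 0 ≤ L)
    (hHL : ∀ α x p q, |H α x p - H α x q| ≤ L * |p - q|) (lam : ℝ) :
    ∃ Λ > 0, lam ≤ Λ ∧ ∀ f : N.EdgeMap, ∃ u : KirchhoffFunction N μ γ,
      ∀ α, ∀ y, ∀ hy : y ∈ Icc (0 : ℝ) (N.ℓ α),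
        -(μ α * u.der2 α y) + H α y (u.der α y) + Λ * u.val α y = f α ⟨y, hy⟩ := by
  obtain ⟨m, hm, hmμ⟩ := exists_pos_forall_le μ hμ
  obtain ⟨l, hl, hlN⟩ := exists_pos_forall_le N.ℓ N.ℓ_pos
  obtain ⟨h, hh, hhl, hhL, hhlam⟩ : ∃ h > 0, h ≤ l ∧ L * (2 + 2 / m) * h ≤ 1 / 2 ∧
      lam ≤ 1 / h ^ 2 := by
    set D := L * (2 + 2 / m) with hD
    have hD0 : 0 ≤ D := by positivity
    refine ⟨min l (min (1 / (2 * (D + 1))) (1 / (|lam| + 1))), by positivity,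
      min_le_left _ _, ?_, ?_⟩
    · calc _ ≤ D * (1 / (2 * (D + 1))) := by
            gcongr; exact (min_le_right _ _).trans (min_le_left _ _)
        _ ≤ 1 / 2 := by
            rw [mul_one_div, div_le_div_iff₀ (by positivity) (by positivity)]; linarith
    · set h := min l (min (1 / (2 * (D + 1))) (1 / (|lam| + 1)))
      have h0 : 0 < h := by positivity
      have h1 : h ≤ 1 / (|lam| + 1) := (min_le_right _ _).trans (min_le_right _ _)
      rw [le_div_iff₀ (by positivity)] at h1
      rw [le_div_iff₀ (by positivity)]
      have h2 : |lam| * h ≤ 1 := by nlinarith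
      have h3 : h ≤ 1 := by nlinarith [abs_nonneg lam]
      nlinarith [le_abs_self lam, mul_le_mul_of_nonneg_right (le_abs_self lam) (sq_nonneg h)]
  refine ⟨1 / h ^ 2, by positivity, hhlam, fun f => ?_⟩
  choose S hS using exists_linear_solution (N := N) hμ hγ (Λ := 1 / h ^ 2) (by positivity)
  let T : N.EdgeMap → N.EdgeMap := fun g α =>
    f α - ⟨fun y => H α y ((S g).derMap α y), (hH α).comp
      (continuous_subtype_val.prodMk ((S g).derMap α).continuous)⟩
  have hTapp : ∀ g α y, T g α y = f α y - H α y ((S g).der α y) := fun _ _ _ => rfl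
  obtain ⟨g, hg⟩ := exists_fixedPoint_of_dist_le T (K := 1 / 2) (by norm_num) (by norm_num) (by
    intro g₁ g₂
    have hlin : ∀ α, ∀ y ∈ Icc (0 : ℝ) (N.ℓ α),
        |-(μ α * ((S g₁).sub (S g₂)).der2 α y) + 1 / h ^ 2 * ((S g₁).sub (S g₂)).val α y|
          ≤ dist g₁ g₂ := by
      intro α y hy
      have h1 := hS g₁ α y hy
      have h2 := hS g₂ α y hy
      have h3 : -(μ α * ((S g₁).sub (S g₂)).der2 α y) + 1 / h ^ 2 * ((S g₁).sub (S g₂)).val α y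
          = g₁ α ⟨y, hy⟩ - g₂ α ⟨y, hy⟩ := by
        simp only [sub]
        linarith
      rw [h3, ← Real.dist_eq]
      exact (ContinuousMap.dist_apply_le_dist _).trans (dist_le_pi_dist g₁ g₂ α)
    have hb := abs_der2_le _ hμ hγ (by positivity) hm hmμ hlin
    have ha := mul_abs_val_le ((S g₁).sub (S g₂)) hμ hγ (by positivity)
      fun α y hy _ => hlin α y hy
    have hd := abs_der_le ((S g₁).sub (S g₂)) (a := h ^ 2 * dist g₁ g₂)
      (fun α y hy => by
        have := ha α y hy
        rwa [one_div, inv_mul_le_iff₀ (by positivity)] at this) hb hh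
      (fun α => hhl.trans (hlN α))
    refine (dist_pi_le_iff (by positivity)).2 fun α =>
      (ContinuousMap.dist_le (by positivity)).2 fun ⟨y, hy⟩ => ?_
    rw [Real.dist_eq, hTapp, hTapp, sub_sub_sub_cancel_left, abs_sub_comm]
    calc _ ≤ L * |(S g₁).der α y - (S g₂).der α y| := hHL ..
      _ ≤ L * (2 * (h ^ 2 * dist g₁ g₂) / h + 2 * dist g₁ g₂ / m * h) := by
          gcongr; exact hd α y hy
      _ = L * (2 + 2 / m) * h * dist g₁ g₂ := by field_simp
      _ ≤ 1 / 2 * dist g₁ g₂ := by gcongr)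
  refine ⟨S g, fun α y hy => ?_⟩
  have h1 := hS g α y hy
  have h2 := hTapp g α ⟨y, hy⟩
  rw [hg] at h2
  simp only at h2
  linarith

/-- Solvability for a Hamiltonian that is Lipschitz in the gradient variable. -/
theorem exists_solution_of_lipschitz (hμ : ∀ α, 0 < μ α)
    (hγ : ∀ i : I, ∀ α ∈ N.edges i, 0 < γ i α) {H : A → ℝ → ℝ → ℝ}
    (hH : ∀ α, Continuous fun z : ℝ × ℝ => H α z.1 z.2) {L : ℝ} (hL : 0 ≤ L)
    (hHL : ∀ α x p q, |H α x p - H α x q| ≤ L * |p - q|) {lam : ℝ} (hlam : 0 < lam) :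
    ∃ u : KirchhoffFunction N μ γ, ∀ α, ∀ y ∈ Icc (0 : ℝ) (N.ℓ α),
      -(μ α * u.der2 α y) + H α y (u.der α y) + lam * u.val α y = 0 := by
  obtain ⟨Λ, hΛ, hle, hR⟩ := exists_solution_of_lipschitz_large (N := N) hμ hγ hH hL hHL lam
  choose R hR using hR
  obtain ⟨f, hf⟩ := exists_fixedPoint_of_dist_le (fun f : N.EdgeMap => (R ((Λ - lam) • f)).valMap)
    (K := (Λ - lam) / Λ) (div_nonneg (by linarith) hΛ.le)
    ((div_lt_one hΛ).2 (by linarith)) (by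
    intro f₁ f₂
    set u₁ := R ((Λ - lam) • f₁) with hu₁
    set u₂ := R ((Λ - lam) • f₂) with hu₂
    have hnn : 0 ≤ (Λ - lam) * dist f₁ f₂ := mul_nonneg (by linarith) dist_nonneg
    have h := mul_abs_val_le (u₁.sub u₂) hμ hγ hΛ (c := (Λ - lam) * dist f₁ f₂)
      (fun α y hy h0 => by
        have h1 := hR ((Λ - lam) • f₁) α y hy
        have h2 := hR ((Λ - lam) • f₂) α y hy
        rw [← hu₁] at h1
        rw [← hu₂] at h2
        have h0' : u₁.der α y = u₂.der α y := sub_eq_zero.1 h0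
        rw [h0'] at h1
        have h3 : -(μ α * (u₁.sub u₂).der2 α y) + Λ * (u₁.sub u₂).val α y
            = (Λ - lam) * (f₁ α ⟨y, hy⟩ - f₂ α ⟨y, hy⟩) := by
          simp only [sub]
          simp only [Pi.smul_apply, ContinuousMap.smul_apply, smul_eq_mul] at h1 h2
          linarith
        rw [h3, abs_mul, abs_of_nonneg (by linarith : 0 ≤ Λ - lam), ← Real.dist_eq]
        exact mul_le_mul_of_nonneg_left
          ((ContinuousMap.dist_apply_le_dist _).trans (dist_le_pi_dist f₁ f₂ α)) (by linarith))
    have hnn' : 0 ≤ (Λ - lam) / Λ * dist f₁ f₂ := by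
      rw [div_mul_eq_mul_div]; positivity
    refine (dist_pi_le_iff hnn').2 fun α => (ContinuousMap.dist_le hnn').2 fun ⟨y, hy⟩ => ?_
    rw [div_mul_eq_mul_div, le_div_iff₀ hΛ, mul_comm]
    exact h α y hy)
  refine ⟨R ((Λ - lam) • f), fun α y hy => ?_⟩
  have h1 := hR ((Λ - lam) • f) α y hy
  have h2 : (R ((Λ - lam) • f)).val α y = f α ⟨y, hy⟩ :=
    congrArg (fun g : N.EdgeMap => g α ⟨y, hy⟩) hf
  simp only [Pi.smul_apply, ContinuousMap.smul_apply, smul_eq_mul] at h1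
  rw [← h2] at h1
  linarith

end KirchhoffFunction

/-- Averaging a bounded continuous function in its second variable gives approximations that are
Lipschitz in that variable. -/
theorem exists_lipschitz_average {H : ℝ → ℝ → ℝ} (hH : Continuous fun z : ℝ × ℝ => H z.1 z.2)
    {C : ℝ} (hC : ∀ x p, |H x p| ≤ C) {h : ℝ} (hh : 0 < h) :
    ∃ K : ℝ → ℝ → ℝ, Continuous (fun z : ℝ × ℝ => K z.1 z.2) ∧ (∀ x p, |K x p| ≤ C) ∧
      (∀ x p q, |K x p - K x q| ≤ 2 * C / h * |p - q|) ∧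
      ∀ x p ε, (∀ q ∈ Icc p (p + h), |H x q - H x p| ≤ ε) → |K x p - H x p| ≤ ε := by
  have hHx : ∀ x, Continuous (H x) := fun x =>
    hH.comp (continuous_const.prodMk continuous_id)
  have hii : ∀ x a b, IntervalIntegrable (H x) MeasureTheory.volume a b := fun x a b =>
    (hHx x).intervalIntegrable a b
  have hbd : ∀ x a b, |∫ t in a..b, H x t| ≤ C * |b - a| := fun x a b => by
    rw [← Real.norm_eq_abs]
    exact intervalIntegral.norm_integral_le_of_norm_le_const fun t _ => hC x t
  refine ⟨fun x p => (∫ t in p..(p + h), H x t) / h, ?_, fun x p => ?_, fun x p q => ?_,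
    fun x p ε hε => ?_⟩
  · have h1 : ∀ s : ℝ × ℝ → ℝ, Continuous s →
        Continuous fun z : ℝ × ℝ => ∫ t in (0 : ℝ)..s z, H z.1 t := fun s hs =>
      intervalIntegral.continuous_parametric_intervalIntegral_of_continuous
        (f := fun (z : ℝ × ℝ) t => H z.1 t)
        (hH.comp ((continuous_fst.comp continuous_fst).prodMk continuous_snd)) hs
    have h2 := (h1 (fun z => z.2 + h) (by fun_prop)).sub (h1 (fun z => z.2) (by fun_prop))
    refine (h2.congr fun z => ?_).div_const h
    exact intervalIntegral.integral_interval_sub_left (hii _ _ _) (hii _ _ _)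
  · rw [abs_div, abs_of_pos hh, div_le_iff₀ hh]
    simpa [abs_of_pos hh] using hbd x p (p + h)
  · rw [← sub_div, abs_div, abs_of_pos hh, div_mul_eq_mul_div, div_le_div_iff_of_pos_right hh]
    have h1 : (∫ t in p..(p + h), H x t) - ∫ t in q..(q + h), H x t
        = (∫ t in p..q, H x t) - ∫ t in (p + h)..(q + h), H x t :=
      intervalIntegral.integral_interval_sub_interval_comm (hii _ _ _) (hii _ _ _) (hii _ _ _)
    have h2 := hbd x p q
    have h3 := hbd x (p + h) (q + h)
    rw [add_sub_add_right_eq_sub] at h3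
    rw [h1, abs_sub_comm p q]
    have := abs_sub (∫ t in p..q, H x t) (∫ t in (p + h)..(q + h), H x t)
    linarith
  · have h1 : (∫ t in p..(p + h), H x t) / h - H x p
        = (∫ t in p..(p + h), (H x t - H x p)) / h := by
      rw [intervalIntegral.integral_sub (hii _ _ _) (by simp)]
      simp [hh.ne', sub_div]
    have h2 : |∫ t in p..(p + h), (H x t - H x p)| ≤ ε * |p + h - p| := by
      rw [← Real.norm_eq_abs]
      refine intervalIntegral.norm_integral_le_of_norm_le_const fun t ht => ?_
      rw [uIoc_of_le (by linarith)] at ht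
      exact hε t (Ioc_subset_Icc_self ht)
    rw [h1, abs_div, abs_of_pos hh, div_le_iff₀ hh]
    simpa [abs_of_pos hh] using h2

namespace KirchhoffFunction

variable {I A : Type} [Fintype I] [Fintype A] [DecidableEq I]
  {N : Network I A} {μ : A → ℝ} {γ : I → A → ℝ}

/-- Interpolation: a small function with bounded second derivative has a small derivative. -/
theorem exists_abs_der_le (N : Network I A) (μ : A → ℝ) (γ : I → A → ℝ) {B ε : ℝ}
    (hB : 0 ≤ B) (hε : 0 < ε) :
    ∃ δ > 0, ∀ u : KirchhoffFunction N μ γ,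
      (∀ α, ∀ y ∈ Icc (0 : ℝ) (N.ℓ α), |u.val α y| ≤ δ) →
      (∀ α, ∀ y ∈ Icc (0 : ℝ) (N.ℓ α), |u.der2 α y| ≤ B) →
      ∀ α, ∀ y ∈ Icc (0 : ℝ) (N.ℓ α), |u.der α y| ≤ ε := by
  obtain ⟨l, hl, hlN⟩ := exists_pos_forall_le N.ℓ N.ℓ_pos
  set h := min l (ε / (2 * (B + 1))) with hh
  have h0 : 0 < h := by positivity
  refine ⟨ε * h / 4, by positivity, fun u ha hb α y hy => ?_⟩
  refine (u.abs_der_le ha hb h0 (fun β => (min_le_left _ _).trans (hlN β)) α y hy).trans ?_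
  have h1 : h ≤ ε / (2 * (B + 1)) := min_le_right _ _
  rw [le_div_iff₀ (by positivity)] at h1
  have h2 : 2 * (ε * h / 4) / h = ε / 2 := by field_simp; norm_num
  rw [h2]
  nlinarith

/-- Solvability for a bounded continuous Hamiltonian. -/
theorem exists_solution (hμ : ∀ α, 0 < μ α)
    (hγ : ∀ i : I, ∀ α ∈ N.edges i, 0 < γ i α) {H : A → ℝ → ℝ → ℝ}
    (hH : ∀ α, Continuous fun z : ℝ × ℝ => H α z.1 z.2) {C : ℝ} (hC0 : 0 ≤ C)
    (hC : ∀ α x p, |H α x p| ≤ C) {lam : ℝ} (hlam : 0 < lam) :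
    ∃ u : KirchhoffFunction N μ γ, ∀ α, ∀ y ∈ Icc (0 : ℝ) (N.ℓ α),
      -(μ α * u.der2 α y) + H α y (u.der α y) + lam * u.val α y = 0 := by
  obtain ⟨m, hm, hmμ⟩ := exists_pos_forall_le μ hμ
  obtain ⟨l, hl, hlN⟩ := exists_pos_forall_le N.ℓ N.ℓ_pos
  set h : ℕ → ℝ := fun n => 1 / ((n : ℝ) + 1) with hhdef
  have hh : ∀ n, 0 < h n := fun n => Nat.one_div_pos_of_nat
  choose K hKc hKb hKL hKH using fun n α => exists_lipschitz_average (hH α) (hC α) (hh n)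
  choose u hu using fun n => exists_solution_of_lipschitz (N := N) (γ := γ) hμ hγ (hKc n)
    (L := 2 * C / h n) (div_nonneg (by positivity) (hh n).le) (hKL n) hlam
  have hlin : ∀ n α, ∀ y ∈ Icc (0 : ℝ) (N.ℓ α),
      |-(μ α * (u n).der2 α y) + lam * (u n).val α y| ≤ C := fun n α y hy => by
    have h1 : -(μ α * (u n).der2 α y) + lam * (u n).val α y = -K n α y ((u n).der α y) := by
      linarith [hu n α y hy]
    rw [h1, abs_neg]
    exact hKb ..
  have hder2 : ∀ n, ∀ α, ∀ y ∈ Icc (0 : ℝ) (N.ℓ α), |(u n).der2 α y| ≤ 2 * C / m := fun n =>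
    abs_der2_le (u n) hμ hγ hlam hm hmμ (hlin n)
  obtain ⟨R, hR⟩ : ∃ R, ∀ n α, ∀ y ∈ Icc (0 : ℝ) (N.ℓ α), |(u n).der α y| ≤ R := by
    refine ⟨_, fun n => abs_der_le (u n) (a := C / lam) (fun α y hy => ?_) (hder2 n) hl hlN⟩
    rw [le_div_iff₀ hlam, mul_comm]
    exact mul_abs_val_le (u n) hμ hγ hlam (fun α y hy _ => hlin n α y hy) α y hy
  -- A common modulus of continuity in the gradient variable.
  have hmod : ∀ ε > 0, ∃ δ > 0, ∀ α, ∀ y ∈ Icc (0 : ℝ) (N.ℓ α), ∀ p q, |p| ≤ R → |q - p| ≤ δ →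
      |H α y q - H α y p| ≤ ε := by
    intro ε hε
    have h1 : ∀ α, ∃ δ > 0, ∀ y ∈ Icc (0 : ℝ) (N.ℓ α), ∀ p q, |p| ≤ R → |q - p| ≤ δ →
        |H α y q - H α y p| ≤ ε := by
      intro α
      have huc := (isCompact_Icc (a := (0 : ℝ)) (b := N.ℓ α)).prod
        (isCompact_Icc (a := -(R + 1)) (b := R + 1)) |>.uniformContinuousOn_of_continuous
        (hH α).continuousOn
      obtain ⟨δ, hδ, hd⟩ := Metric.uniformContinuousOn_iff_le.1 huc ε hε
      refine ⟨min δ 1, by positivity, fun y hy p q hp hpq => ?_⟩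
      have h2 := abs_le.1 hp
      have h3 := abs_le.1 (hpq.trans (min_le_right _ _))
      refine hd (y, q) ⟨hy, ?_, ?_⟩ (y, p) ⟨hy, ?_, ?_⟩ ?_
      any_goals (simp only; linarith)
      rw [Prod.dist_eq]
      simpa [Real.dist_eq, hδ.le] using hpq.trans (min_le_left _ _)
    choose δ hδ hd using h1
    obtain ⟨d, hd0, hdδ⟩ := exists_pos_forall_le δ hδ
    exact ⟨d, hd0, fun α y hy p q hp hpq => hd α y hy p q hp (hpq.trans (hdδ α))⟩
  have happrox : ∀ ε > 0, ∃ n₀, ∀ n ≥ n₀, ∀ α, ∀ y ∈ Icc (0 : ℝ) (N.ℓ α), ∀ p, |p| ≤ R →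
      |K n α y p - H α y p| ≤ ε := by
    intro ε hε
    obtain ⟨δ, hδ, hd⟩ := hmod ε hε
    obtain ⟨n₀, hn₀⟩ := exists_nat_one_div_lt hδ
    refine ⟨n₀, fun n hn α y hy p hp => hKH n α y p ε fun q hq => hd α y hy p q hp ?_⟩
    rw [abs_of_nonneg (by linarith [hq.1])]
    have : h n ≤ h n₀ := Nat.one_div_le_one_div hn
    have h4 : h n₀ < δ := hn₀
    linarith [hq.2]
  have hcauchy : CauchySeq fun n => (u n).derMap := by
    refine Metric.cauchySeq_iff.2 fun ε hε => ?_
    obtain ⟨δ, hδ, hd⟩ := exists_abs_der_le N μ γ (B := 2 * C / m + 2 * C / m)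
      (by positivity) (half_pos hε)
    obtain ⟨n₀, hn₀⟩ := happrox (lam * δ / 2) (by positivity)
    refine ⟨n₀, fun n hn k hk => lt_of_le_of_lt ?_ (half_lt_self hε)⟩
    refine (dist_pi_le_iff (half_pos hε).le).2 fun α =>
      (ContinuousMap.dist_le (half_pos hε).le).2 fun ⟨y, hy⟩ => ?_
    refine hd ((u n).sub (u k)) (fun α y hy => ?_) (fun α y hy => ?_) α y hy
    · refine le_of_mul_le_mul_left (mul_abs_val_le ((u n).sub (u k)) hμ hγ hlam
        (fun α y hy h0 => ?_) α y hy) hlam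
      have h0' : (u n).der α y = (u k).der α y := sub_eq_zero.1 h0
      have h1 := hu n α y hy
      have h2 := hu k α y hy
      rw [h0'] at h1
      have h3 := abs_le.1 (hn₀ n hn α y hy _ (hR k α y hy))
      have h4 := abs_le.1 (hn₀ k hk α y hy _ (hR k α y hy))
      simp only [sub]
      refine abs_le.2 ⟨?_, ?_⟩ <;> linarith [h3.1, h3.2, h4.1, h4.2]
    · exact (abs_sub _ _).trans (add_le_add (hder2 n α y hy) (hder2 k α y hy))
  obtain ⟨P, hP⟩ := cauchySeq_tendsto_of_complete hcauchy
  let g : N.EdgeMap := fun α => -⟨fun y => H α y (P α y), (hH α).comp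
    (continuous_subtype_val.prodMk (P α).continuous)⟩
  obtain ⟨w, hw⟩ := exists_linear_solution (N := N) (γ := γ) hμ hγ hlam g
  have hg : ∀ α y, g α y = -H α y (P α y) := fun _ _ => rfl
  have hw2 : ∀ α, ∀ y ∈ Icc (0 : ℝ) (N.ℓ α), |w.der2 α y| ≤ 2 * C / m :=
    abs_der2_le w hμ hγ hlam hm hmμ fun α y hy => by
      rw [hw α y hy, hg, abs_neg]
      exact hC ..
  have hwP : ∀ α y, ∀ hy : y ∈ Icc (0 : ℝ) (N.ℓ α), w.der α y = P α ⟨y, hy⟩ := by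
    intro α y hy
    refine eq_of_forall_dist_le fun ε hε => ?_
    obtain ⟨δ, hδ, hd⟩ := exists_abs_der_le N μ γ (B := 2 * C / m + 2 * C / m)
      (by positivity) (half_pos hε)
    obtain ⟨n₀, hn₀⟩ := happrox (lam * δ / 2) (by positivity)
    obtain ⟨η, hη, hη'⟩ := hmod (lam * δ / 2) (by positivity)
    obtain ⟨n₁, hn₁⟩ := Metric.tendsto_atTop.1 hP (min η (ε / 2)) (by positivity)
    set n := max n₀ n₁ with hn
    have hdist : ∀ α, ∀ y, ∀ hy : y ∈ Icc (0 : ℝ) (N.ℓ α),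
        |P α ⟨y, hy⟩ - (u n).der α y| ≤ min η (ε / 2) := fun α y hy => by
      rw [abs_sub_comm, ← Real.dist_eq]
      exact ((ContinuousMap.dist_apply_le_dist (f := (u n).derMap α) (g := P α) ⟨y, hy⟩).trans
        (dist_le_pi_dist (u n).derMap P α)).trans (hn₁ n (le_max_right _ _)).le
    have h1 : |w.der α y - (u n).der α y| ≤ ε / 2 := by
      refine hd (w.sub (u n)) (fun α y hy => ?_) (fun α y hy => ?_) α y hy
      · refine le_of_mul_le_mul_left (mul_abs_val_le (w.sub (u n)) hμ hγ hlam
          (fun α y hy _ => ?_) α y hy) hlam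
        have h1 := hw α y hy
        have h2 := hu n α y hy
        rw [hg] at h1
        have h3 := abs_le.1 (hn₀ n (le_max_left _ _) α y hy _ (hR n α y hy))
        have h4 := abs_le.1 (hη' α y hy _ _ (hR n α y hy)
          ((hdist α y hy).trans (min_le_left _ _)))
        simp only [sub]
        simp only at h1
        refine abs_le.2 ⟨?_, ?_⟩ <;> linarith [h3.1, h3.2, h4.1, h4.2]
      · exact (abs_sub _ _).trans (add_le_add (hw2 α y hy) (hder2 n α y hy))
    have h2 := (hdist α y hy).trans (min_le_right _ _)
    rw [Real.dist_eq]
    rw [abs_le] at h1 h2 ⊢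
    constructor <;> linarith [h1.1, h1.2, h2.1, h2.2]
  refine ⟨w, fun α y hy => ?_⟩
  have h1 := hw α y hy
  rw [hg, ← hwP] at h1
  linarith

theorem lipschitzOnWith_der2 (u : KirchhoffFunction N μ γ) {H : A → ℝ → ℝ → ℝ} {lam : ℝ} {α : A}
    (hμα : 0 < μ α) (hsol : ∀ y ∈ Icc (0 : ℝ) (N.ℓ α),
      -(μ α * u.der2 α y) + H α y (u.der α y) + lam * u.val α y = 0)
    (hH : ∀ R : ℝ, ∃ K : NNReal, LipschitzOnWith K (fun z : ℝ × ℝ => H α z.1 z.2)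
      (Icc (0 : ℝ) (N.ℓ α) ×ˢ Icc (-R) R)) :
    ∃ K : NNReal, LipschitzOnWith K (u.der2 α) (Icc (0 : ℝ) (N.ℓ α)) := by
  have hlip : ∀ f f' : ℝ → ℝ, ContinuousOn f' (Icc (0 : ℝ) (N.ℓ α)) →
      (∀ y ∈ Icc (0 : ℝ) (N.ℓ α), HasDerivWithinAt f (f' y) (Icc 0 (N.ℓ α)) y) →
      ∃ B : NNReal, LipschitzOnWith B f (Icc (0 : ℝ) (N.ℓ α)) := by
    intro f f' hf' hf
    obtain ⟨B, hB⟩ := isCompact_Icc.exists_bound_of_continuousOn hf'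
    exact ⟨B.toNNReal, (convex_Icc _ _).lipschitzOnWith_of_nnnorm_hasDerivWithin_le hf
      fun y hy => by
        rw [← NNReal.coe_le_coe, coe_nnnorm]
        exact (hB y hy).trans (Real.le_coe_toNNReal B)⟩
  have hc : ContinuousOn (u.der α) (Icc 0 (N.ℓ α)) := fun y hy =>
    (u.isC2.2.1 α y hy).continuousWithinAt
  obtain ⟨B₁, hB₁⟩ := hlip (u.val α) (u.der α) hc (u.isC2.1 α)
  obtain ⟨B₂, hB₂⟩ := hlip (u.der α) (u.der2 α) (u.isC2.2.2.1 α) (u.isC2.2.1 α)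
  obtain ⟨R, hR⟩ := isCompact_Icc.exists_bound_of_continuousOn hc
  obtain ⟨K, hK⟩ := hH R
  have h1 : LipschitzOnWith (K * max 1 B₂) (fun y => H α y (u.der α y)) (Icc 0 (N.ℓ α)) :=
    hK.comp (LipschitzOnWith.prodMk LipschitzWith.id.lipschitzOnWith hB₂)
      fun y hy => ⟨hy, abs_le.1 (hR y hy)⟩
  obtain ⟨L, hL⟩ : ∃ L : NNReal, LipschitzOnWith L
      (fun y => (μ α)⁻¹ * (H α y (u.der α y) + lam * u.val α y)) (Icc 0 (N.ℓ α)) :=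
    ⟨_, (lipschitzWith_smul (μ α)⁻¹).comp_lipschitzOnWith
      (h1.add ((lipschitzWith_smul lam).comp_lipschitzOnWith hB₁))⟩
  have heq : ∀ y ∈ Icc (0 : ℝ) (N.ℓ α),
      u.der2 α y = (μ α)⁻¹ * (H α y (u.der α y) + lam * u.val α y) := fun y hy => by
    have := hsol y hy
    field_simp
    linarith
  refine ⟨L, fun x hx y hy => ?_⟩
  rw [heq x hx, heq y hy]
  exact hL hx hy

end KirchhoffFunction

/-- existence of a classical solution of the HJB boundary value problem
`−μ_α v'' + H_α(y, v') + λ v = 0` with Kirchhoff conditions, for a bounded continuous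
Hamiltonian; if moreover each `H_α` is locally Lipschitz, the solution can be taken with
`v''_α` Lipschitz continuous on each edge. -/
theorem stmt_8 {I A : Type} [Fintype I] [Fintype A] [DecidableEq I]
    (N : Network I A) (μ : A → ℝ) (γ : I → A → ℝ)
    (hμ : ∀ α, 0 < μ α) (hγ : ∀ i : I, ∀ α ∈ N.edges i, 0 < γ i α)
    (lam C_H : ℝ) (hlam : 0 < lam) (hCH : 0 < C_H)
    (H : A → ℝ → ℝ → ℝ)
    (hHcont : ∀ α, ContinuousOn (fun z : ℝ × ℝ => H α z.1 z.2)
      (Icc (0:ℝ) (N.ℓ α) ×ˢ (univ : Set ℝ)))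
    (hHbdd : ∀ α, ∀ x ∈ Icc (0:ℝ) (N.ℓ α), ∀ p : ℝ, |H α x p| ≤ C_H) :
    (∃ v v' v'' : A → ℝ → ℝ,
      Network.IsC2 N v v' v'' ∧
      (∀ α : A, ∀ y ∈ Ioo (0:ℝ) (N.ℓ α),
        -(μ α * v'' α y) + H α y (v' α y) + lam * v α y = 0) ∧
      Network.Kirchhoff N μ γ v') ∧
    ((∀ α : A, ∀ R : ℝ, ∃ K : NNReal, LipschitzOnWith K
        (fun z : ℝ × ℝ => H α z.1 z.2) (Icc (0:ℝ) (N.ℓ α) ×ˢ Icc (-R) R)) →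
      ∃ v v' v'' : A → ℝ → ℝ,
        Network.IsC2 N v v' v'' ∧
        (∀ α : A, ∀ y ∈ Ioo (0:ℝ) (N.ℓ α),
          -(μ α * v'' α y) + H α y (v' α y) + lam * v α y = 0) ∧
        Network.Kirchhoff N μ γ v' ∧
        (∀ α : A, ∃ K : NNReal, LipschitzOnWith K (v'' α) (Icc (0:ℝ) (N.ℓ α)))) := by
  have hle := fun α => (N.ℓ_pos α).le
  obtain ⟨u, hu⟩ := KirchhoffFunction.exists_solution (N := N) (γ := γ) hμ hγ
    (H := fun α x p => H α (projIcc 0 (N.ℓ α) (hle α) x) p)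
    (fun α => (hHcont α).comp_continuous
      (f := fun z : ℝ × ℝ => (((projIcc 0 (N.ℓ α) (hle α) z.1 : Icc (0:ℝ) (N.ℓ α)) : ℝ), z.2))
      ((continuous_subtype_val.comp (continuous_projIcc.comp continuous_fst)).prodMk
        continuous_snd)
      fun z => ⟨(projIcc 0 (N.ℓ α) (hle α) z.1).2, mem_univ _⟩)
    hCH.le (fun α x p => hHbdd α _ (projIcc 0 (N.ℓ α) (hle α) x).2 p) hlam
  have hsol : ∀ α : A, ∀ y ∈ Icc (0:ℝ) (N.ℓ α),
      -(μ α * u.der2 α y) + H α y (u.der α y) + lam * u.val α y = 0 := fun α y hy => by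
    have h := hu α y hy
    rwa [projIcc_of_mem (hle α) hy] at h
  have hsol' := fun α y (hy : y ∈ Ioo (0:ℝ) (N.ℓ α)) => hsol α y (Ioo_subset_Icc_self hy)
  exact ⟨⟨u.val, u.der, u.der2, u.isC2, hsol', u.kirchhoff⟩, fun hLip =>
    ⟨u.val, u.der, u.der2, u.isC2, hsol', u.kirchhoff, fun α =>
      u.lipschitzOnWith_der2 (hμ α) (hsol α) (hLip α)⟩⟩
end
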